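/- arXiv:2502.17918 — 5 statements merged into one kernel-verified Lean document; each statement's English description precedes it below -/
import Mathlib

section
/- Let X be a real inner product space, let ψ > 1 and θ > 0 be real numbers, and let u, v, w ∈ X. Then (ψθ(1 + ψ − ψ²θ)/(ψ+1))·‖u − v‖² ≤ (1 + 1/ψ − ψθ)·‖u − w‖² + ψθ·‖v − w‖². -/
open Filter Topology

local notation "⟪" x ", " y "⟫_ℝ" => @inner ℝ _ _ x y

theorem three_point_inequality {X : Type*}
    [NormedAddCommGroup X] [InnerProductSpace ℝ X]
    (ψ θ : ℝ) (hψ : 1 < ψ) (hθ : 0 < θ) (u v w : X) :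
    ψ * θ * (1 + ψ - ψ ^ 2 * θ) / (ψ + 1) * ‖u - v‖ ^ 2 ≤
      (1 + 1 / ψ - ψ * θ) * ‖u - w‖ ^ 2 + ψ * θ * ‖v - w‖ ^ 2 := by
  have h0 : (0:ℝ) < ψ := by linarith
  have h1 : (0:ℝ) < ψ + 1 := by linarith
  have huv : u - v = (u - w) - (v - w) := by abel
  rw [huv]
  generalize u - w = p
  generalize v - w = q
  have h2 : 0 ≤ ψ / (ψ + 1) * ‖(1 + 1 / ψ - ψ * θ) • p + (ψ * θ) • q‖ ^ 2 := by positivity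
  rw [norm_add_sq_real, inner_smul_left, inner_smul_right, norm_smul, norm_smul, mul_pow, mul_pow,
    Real.norm_eq_abs, Real.norm_eq_abs, sq_abs, sq_abs] at h2
  rw [norm_sub_sq_real]
  simp only [conj_trivial] at h2
  rw [← sub_nonneg]
  refine h2.trans_eq ?_
  field_simp
  ring
end

section
/- Under the P-GRPDA assumptions, there exists a natural number n₂ such that for every n ≥ n₂ and every y ∈ Y: 2τ_n·𝕁(x_n, w_n, y) + (ψ/(ψ−1))·‖x̄ − z_{n+2}‖² + (1/β)·‖y − y_n‖² + μ'·‖x_n − x_{n+1}‖² ≤ (ψ/(ψ−1))·‖x̄ − z_{n+1}‖² + (1/β)·‖y − y_{n−1}‖² + μ'·‖x_n − x_{n−1}‖² − ψ·(τ_n/τ_{n−1})·‖x_n − z_{n+1}‖². -/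
open Filter Topology

local notation "⟪" x ", " y "⟫_ℝ" => @inner ℝ _ _ x y


theorem aux_grad {X : Type*} [NormedAddCommGroup X] [InnerProductSpace ℝ X]
    [FiniteDimensional ℝ X] (h : X → ℝ) (Gh : X → X) (hh : ConvexOn ℝ Set.univ h)
    (hGh : ∀ a : X, HasGradientAt h (Gh a) a) (a b : X) :
    h a + ⟪Gh a, b - a⟫_ℝ ≤ h b := by
  have hc : ConvexOn ℝ Set.univ (h ∘ (AffineMap.lineMap a b : ℝ →ᵃ[ℝ] X)) := by
    simpa using hh.comp_affineMap (AffineMap.lineMap a b : ℝ →ᵃ[ℝ] X)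
  have hd : HasDerivAt (h ∘ (AffineMap.lineMap a b : ℝ →ᵃ[ℝ] X)) (⟪Gh a, b - a⟫_ℝ) 0 := by
    have h1 : HasDerivAt (fun t : ℝ => (AffineMap.lineMap a b : ℝ →ᵃ[ℝ] X) t) (b - a) 0 :=
      AffineMap.hasDerivAt_lineMap
    have h2 := (hGh a).hasFDerivAt
    have h3 : HasFDerivAt h (InnerProductSpace.toDual ℝ X (Gh a))
        ((AffineMap.lineMap a b : ℝ →ᵃ[ℝ] X) (0:ℝ)) := by simpa using h2
    have h4 := h3.comp_hasDerivAt (0:ℝ) h1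
    simpa using h4
  have := hc.le_slope_of_hasDerivAt (Set.mem_univ 0) (Set.mem_univ 1) zero_lt_one hd
  simp [slope_def_field] at this
  linarith

theorem aux_ratio (τ : ℕ → ℝ) (c : ℝ) (hc : 0 < c) (hlo : ∀ n, c ≤ τ n)
    (hmon : ∀ n, τ (n+1) ≤ τ n) (ψ μ ν : ℝ) (hlt : 2 * ν + μ ^ 2 < ψ) :
    ∃ N : ℕ, ∀ n, N ≤ n →
      2 * ν + (τ (n+1) / τ (n+2)) ^ 2 * μ ^ 2 ≤ ψ * (τ (n+1) / τ n) := by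
  have hanti : Antitone τ := antitone_nat_of_succ_le hmon
  have hT := tendsto_atTop_ciInf hanti ⟨c, by rintro _ ⟨n, rfl⟩; exact hlo n⟩
  set l := ⨅ i, τ i
  have hl : l ≠ 0 := (lt_of_lt_of_le hc (le_ciInf hlo)).ne'
  have h1 := (tendsto_add_atTop_iff_nat 1).2 hT
  have h2 := (tendsto_add_atTop_iff_nat 2).2 hT
  have hA : Tendsto (fun n => 2 * ν + (τ (n+1) / τ (n+2)) ^ 2 * μ ^ 2) atTop
      (𝓝 (2 * ν + (l / l) ^ 2 * μ ^ 2)) :=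
    (((h1.div h2 hl).pow 2).mul_const _).const_add _
  have hB : Tendsto (fun n => ψ * (τ (n+1) / τ n)) atTop (𝓝 (ψ * (l / l))) :=
    (h1.div hT hl).const_mul _
  have hlt' : 2 * ν + (l / l) ^ 2 * μ ^ 2 < ψ * (l / l) := by
    rw [div_self hl]; linarith
  obtain ⟨N, hN⟩ := eventually_atTop.1 (hA.eventually_lt hB hlt')
  exact ⟨N, fun n hn => (hN n hn).le⟩

theorem aux_x {X : Type*} [NormedAddCommGroup X] [InnerProductSpace ℝ X]
    (a b c : X) (ψ δ : ℝ) (hψ1 : 1 < ψ) (hψ : ψ ^ 2 ≤ ψ + 1) (hδ : δ ≤ 1) :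
    2 * ⟪a, b - a⟫_ℝ + 2 * δ * ⟪ψ • c, a - c⟫_ℝ ≤
      ψ / (ψ - 1) * ‖b‖ ^ 2 - ψ / (ψ - 1) * ‖b - ((ψ - 1) / ψ) • a‖ ^ 2
        - ψ * δ * ‖c‖ ^ 2 - ψ * δ * ‖a - c‖ ^ 2 := by
  have h0 : ψ * δ - 1 - 1 / ψ ≤ 0 := by
    have : ψ ≤ 1 + 1 / ψ := by
      have hp : 0 < ψ := by linarith
      rw [← sub_nonneg]
      have : 1 + 1 / ψ - ψ = (ψ + 1 - ψ ^ 2) / ψ := by field_simp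
      rw [this]; exact div_nonneg (by linarith) hp.le
    nlinarith
  have hψ0 : ψ ≠ 0 := by linarith
  have hψ2 : ψ - 1 ≠ 0 := by linarith
  have key : ψ / (ψ - 1) * ‖b‖ ^ 2 - ψ / (ψ - 1) * ‖b - ((ψ - 1) / ψ) • a‖ ^ 2
        - ψ * δ * ‖c‖ ^ 2 - ψ * δ * ‖a - c‖ ^ 2
        - (2 * ⟪a, b - a⟫_ℝ + 2 * δ * ⟪ψ • c, a - c⟫_ℝ)
      = - (ψ * δ - 1 - 1 / ψ) * ‖a‖ ^ 2 := by
    simp only [@norm_sub_sq_real, inner_sub_right, inner_smul_left, inner_smul_right,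
      norm_smul, mul_pow, Real.norm_eq_abs, sq_abs, real_inner_self_eq_norm_sq,
      real_inner_comm b a, real_inner_comm c a, conj_trivial]
    field_simp
    ring
  nlinarith [sq_nonneg ‖a‖]

theorem aux_y {Y : Type*} [NormedAddCommGroup Y] [InnerProductSpace ℝ Y]
    (p q r : Y) : 2 * ⟪p - q, q - r⟫_ℝ = ‖p - r‖ ^ 2 - ‖p - q‖ ^ 2 - ‖q - r‖ ^ 2 := by
  have : p - r = (p - q) + (q - r) := by abel
  rw [this, norm_add_sq_real]; ring

theorem aux_step (t N M c d r : ℝ) (hM : 0 ≤ M) (hr : 0 < r)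
    (ht : t ≤ (if M = 0 then d else c * N / (r * M))) (hN : 0 ≤ c * N) :
    t * M ≤ c * N / r := by
  split_ifs at ht with h0
  · rw [h0, mul_zero]; positivity
  · have hM' : 0 < M := lt_of_le_of_ne hM (Ne.symm h0)
    rw [le_div_iff₀ (by positivity)] at ht
    rw [le_div_iff₀ hr]; linarith

theorem aux_low (N M c d r e Q : ℝ) (hM : 0 ≤ M) (hc : 0 < c) (hr : 0 < r) (hQ : 0 < Q)
    (hMN : M ≤ Q * N) (hd : e ≤ d) (he : e ≤ c / (r * Q)) :
    e ≤ (if M = 0 then d else c * N / (r * M)) := by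
  split_ifs with h0
  · exact hd
  · have hM' : 0 < M := lt_of_le_of_ne hM (Ne.symm h0)
    refine he.trans ?_
    rw [div_le_div_iff₀ (by positivity) (by positivity)]
    nlinarith [mul_le_mul_of_nonneg_left hMN (mul_pos hc hr).le]

set_option maxHeartbeats 1000000 in
theorem pgrpda_key_lemma {X Y : Type*}
    [NormedAddCommGroup X] [InnerProductSpace ℝ X] [FiniteDimensional ℝ X]
    [NormedAddCommGroup Y] [InnerProductSpace ℝ Y] [FiniteDimensional ℝ Y]
    (K : X →L[ℝ] Y) (hK : K ≠ 0)
    (f : X → ℝ) (g : Y → ℝ) (h : X → ℝ) (Gh : X → X)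
    (hf : ConvexOn ℝ Set.univ f) (hg : ConvexOn ℝ Set.univ g)
    (hh : ConvexOn ℝ Set.univ h)
    (hGh : ∀ a : X, HasGradientAt h (Gh a) a)
    (L : ℝ) (hL : 0 < L) (hLip : ∀ a b : X, ‖Gh a - Gh b‖ ≤ L * ‖a - b‖)
    (ψ β μ μ' : ℝ) (hψ1 : 1 < ψ) (hψφ : ψ ≤ (1 + Real.sqrt 5) / 2)
    (hβ : 0 < β) (hμ'0 : 0 < μ') (hμμ' : 2 * μ' < μ) (hμψ : μ < ψ / 2)
    (xb : X) (wb yb : Y)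
    (hsaddle : ∀ (x' : X) (w' y' : Y),
      f xb + h xb + g wb + ⟪y', K xb - wb⟫_ℝ ≤
          f xb + h xb + g wb + ⟪yb, K xb - wb⟫_ℝ ∧
        f xb + h xb + g wb + ⟪yb, K xb - wb⟫_ℝ ≤
          f x' + h x' + g w' + ⟪yb, K x' - w'⟫_ℝ)
    (x z : ℕ → X) (w y : ℕ → Y) (τ : ℕ → ℝ)
    (hτ0 : 0 < τ 0) (hz0 : z 0 = x 0)
    (hz : ∀ n, 1 ≤ n → z n = ((ψ - 1) / ψ) • x (n - 1) + (1 / ψ) • z (n - 1))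
    (hx : ∀ n, 1 ≤ n → ∀ u : X,
      τ (n - 1) * (f (x n) - f u) ≤
        ⟪x n - z n + τ (n - 1) • (ContinuousLinearMap.adjoint K) (y (n - 1))
            + τ (n - 1) • Gh (x (n - 1)), u - x n⟫_ℝ)
    (hτ : ∀ n, 1 ≤ n → τ n = min (τ (n - 1)) (min
        (if ‖K (x n - x (n - 1))‖ = 0 then τ (n - 1)
          else μ * ‖x n - x (n - 1)‖ / (Real.sqrt β * ‖K (x n - x (n - 1))‖))
        (if ‖Gh (x n) - Gh (x (n - 1))‖ = 0 then τ (n - 1)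
          else μ' * ‖x n - x (n - 1)‖ / ‖Gh (x n) - Gh (x (n - 1))‖)))
    (hw : ∀ n, 1 ≤ n → ∀ v : Y,
      g (w n) - g v ≤ ⟪y (n - 1) + (β * τ n) • (K (x n) - w n), w n - v⟫_ℝ)
    (hy : ∀ n, 1 ≤ n → y n = y (n - 1) + (β * τ n) • (K (x n) - w n)) :
    ∃ n₂ : ℕ, ∀ n, n₂ ≤ n → ∀ y' : Y,
      2 * τ n * ((f (x n) + h (x n) + g (w n) + ⟪y', K (x n) - (w n)⟫_ℝ)
          - (f xb + h xb + g wb + ⟪y', K xb - wb⟫_ℝ))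
        + ψ / (ψ - 1) * ‖xb - z (n + 2)‖ ^ 2
        + 1 / β * ‖y' - y n‖ ^ 2 + μ' * ‖x n - x (n + 1)‖ ^ 2
      ≤ ψ / (ψ - 1) * ‖xb - z (n + 1)‖ ^ 2 + 1 / β * ‖y' - y (n - 1)‖ ^ 2
        + μ' * ‖x n - x (n - 1)‖ ^ 2
        - ψ * (τ n / τ (n - 1)) * ‖x n - z (n + 1)‖ ^ 2 := by
  have hψ0 : 0 < ψ := by linarith
  have hψsq : ψ ^ 2 ≤ ψ + 1 := by
    have h5 := Real.sq_sqrt (show (0:ℝ) ≤ 5 by norm_num)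
    have h50 := Real.sqrt_nonneg 5
    nlinarith
  have hμ0 : 0 < μ := by linarith
  have hsβ : 0 < Real.sqrt β := Real.sqrt_pos.2 hβ
  have hKn : 0 < ‖K‖ := norm_pos_iff.2 hK
  have hwb : K xb = wb := by
    have := (hsaddle xb wb (yb + (K xb - wb))).1
    rw [inner_add_left, real_inner_self_eq_norm_sq] at this
    have h0 : ‖K xb - wb‖ ^ 2 ≤ 0 := by linarith
    have h1 : ‖K xb - wb‖ = 0 := by nlinarith [norm_nonneg (K xb - wb)]
    exact sub_eq_zero.1 (norm_eq_zero.1 h1)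
  have hmon : ∀ n, τ (n+1) ≤ τ n := fun n => by
    rw [hτ (n+1) (by omega)]; exact min_le_left _ _
  have hτK : ∀ n, τ (n+1) * ‖K (x (n+1) - x n)‖ ≤ μ * ‖x (n+1) - x n‖ / Real.sqrt β := fun n => by
    have h1 := hτ (n+1) (by omega)
    simp only [Nat.add_sub_cancel] at h1
    exact aux_step _ _ _ μ (τ n) _ (norm_nonneg _) hsβ
      (h1.le.trans ((min_le_right _ _).trans (min_le_left _ _))) (by positivity)
  have hτG : ∀ n, τ (n+1) * ‖Gh (x (n+1)) - Gh (x n)‖ ≤ μ' * ‖x (n+1) - x n‖ := fun n => by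
    have h1 := hτ (n+1) (by omega)
    simp only [Nat.add_sub_cancel] at h1
    have := aux_step (τ (n+1)) ‖x (n+1) - x n‖ ‖Gh (x (n+1)) - Gh (x n)‖ μ' (τ n) 1
      (norm_nonneg _) one_pos
      (by rw [one_mul]; exact h1.le.trans ((min_le_right _ _).trans (min_le_right _ _)))
      (by positivity)
    simpa using this
  set e : ℝ := min (τ 0) (min (μ / (Real.sqrt β * ‖K‖)) (μ' / (1 * L))) with he
  have he0 : 0 < e := by
    refine lt_min hτ0 (lt_min ?_ ?_) <;> positivity
  have hlo : ∀ n, e ≤ τ n := by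
    intro n
    induction n with
    | zero => exact min_le_left _ _
    | succ n ih =>
      have h1 := hτ (n+1) (by omega)
      simp only [Nat.add_sub_cancel] at h1
      rw [h1]
      refine le_min ih (le_min ?_ ?_)
      · exact aux_low _ _ μ _ _ _ ‖K‖ (norm_nonneg _) hμ0 hsβ hKn (K.le_opNorm _) ih
          ((min_le_right _ _).trans (min_le_left _ _))
      · have := aux_low ‖x (n+1) - x n‖ ‖Gh (x (n+1)) - Gh (x n)‖ μ' (τ n) 1 e L
          (norm_nonneg _) hμ'0 one_pos hL (hLip _ _) ih
          ((min_le_right _ _).trans (min_le_right _ _))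
        simpa only [one_mul] using this
  have hτpos : ∀ n, 0 < τ n := fun n => he0.trans_le (hlo n)
  have hψ2 : ψ < 2 := by nlinarith
  obtain ⟨N, hN⟩ := aux_ratio τ e he0 hlo hmon ψ μ μ' (by nlinarith)
  refine ⟨N + 1, ?_⟩
  intro n hn y'
  obtain ⟨m, rfl⟩ : ∃ m, n = m + 1 := ⟨n - 1, by omega⟩
  have hR := hN m (by omega)
  have ex1 := hx (m+2) (by omega) xb
  have ex2 := hx (m+1) (by omega) (x (m+2))
  have ez1 := hz (m+3) (by omega)
  have ez2 := hz (m+2) (by omega)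
  have ew := hw (m+1) (by omega) wb
  have ey := hy (m+1) (by omega)
  have egK := hτK (m+1)
  have egG := hτG m
  have ehh := aux_grad h Gh hh hGh (x (m+1)) xb
  rw [← ey] at ew
  simp only [Nat.add_sub_cancel, show m + 2 - 1 = m + 1 from rfl, show m + 3 - 1 = m + 2 from rfl,
    show m + 1 + 1 = m + 2 from rfl, show m + 1 + 2 = m + 3 from rfl] at *
  have t0 := hτpos m
  have t1 := hτpos (m+1)
  have t2 := hτpos (m+2)
  set δ := τ (m+1) / τ m with hδ
  have hδ0 : 0 < δ := div_pos t1 t0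
  have hδ1 : δ ≤ 1 := (div_le_one t0).2 (hmon m)
  have hδτ : δ * τ m = τ (m+1) := div_mul_cancel₀ _ t0.ne'
  -- the x part
  have hzb : xb - z (m+3) = (xb - z (m+2)) - ((ψ - 1) / ψ) • (x (m+2) - z (m+2)) := by
    rw [ez1]
    have : (1 / ψ) = 1 - (ψ - 1) / ψ := by field_simp; ring
    rw [this]; module
  have hzc : x (m+1) - z (m+1) = ψ • (x (m+1) - z (m+2)) := by
    rw [ez2, smul_sub, smul_add, smul_smul, smul_smul, mul_div_cancel₀ _ hψ0.ne',
      mul_div_cancel₀ _ hψ0.ne']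
    module
  have hX := aux_x (x (m+2) - z (m+2)) (xb - z (m+2)) (x (m+1) - z (m+2)) ψ δ hψ1 hψsq hδ1
  rw [← hzb, ← hzc] at hX
  rw [show xb - z (m+2) - (x (m+2) - z (m+2)) = xb - x (m+2) by abel,
    show x (m+2) - z (m+2) - (x (m+1) - z (m+2)) = x (m+2) - x (m+1) by abel] at hX
  -- expand the prox inequalities
  simp only [inner_add_left, inner_smul_left, conj_trivial,
    ContinuousLinearMap.adjoint_inner_left] at ex1 ex2
  have ex2' := mul_le_mul_of_nonneg_left ex2 hδ0.le
  have ex3 : τ (m+1) * (f (x (m+1)) - f (x (m+2))) ≤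
      δ * ⟪x (m+1) - z (m+1), x (m+2) - x (m+1)⟫_ℝ
        + τ (m+1) * ⟪y m, K (x (m+2) - x (m+1))⟫_ℝ
        + τ (m+1) * ⟪Gh (x m), x (m+2) - x (m+1)⟫_ℝ := by
    rw [← hδτ]; linarith
  -- gradient part
  have hG : 2 * τ (m+1) * ⟪Gh (x (m+1)) - Gh (x m), x (m+1) - x (m+2)⟫_ℝ ≤
      μ' * ‖x (m+1) - x m‖ ^ 2 + μ' * ‖x (m+1) - x (m+2)‖ ^ 2 := by
    have c1 := real_inner_le_norm (Gh (x (m+1)) - Gh (x m)) (x (m+1) - x (m+2))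
    have c2 := mul_le_mul_of_nonneg_left c1 t1.le
    have c3 := mul_le_mul_of_nonneg_right egG (norm_nonneg (x (m+1) - x (m+2)))
    nlinarith [mul_nonneg hμ'0.le (sq_nonneg (‖x (m+1) - x m‖ - ‖x (m+1) - x (m+2)‖))]
  -- K part
  have hKp : 2 * τ (m+1) * ⟪y (m+1) - y m, K (x (m+1) - x (m+2))⟫_ℝ ≤
      1 / β * ‖y (m+1) - y m‖ ^ 2
        + (τ (m+1) / τ (m+2)) ^ 2 * μ ^ 2 * ‖x (m+1) - x (m+2)‖ ^ 2 := by
    have c1 := real_inner_le_norm (y (m+1) - y m) (K (x (m+1) - x (m+2)))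
    have n1 : ‖K (x (m+1) - x (m+2))‖ = ‖K (x (m+2) - x (m+1))‖ := by
      rw [← norm_neg, ← map_neg, neg_sub]
    rw [norm_sub_rev (x (m+2)) (x (m+1)), ← n1] at egK
    have c2 : ‖K (x (m+1) - x (m+2))‖ ≤ μ * ‖x (m+1) - x (m+2)‖ / Real.sqrt β / τ (m+2) := by
      rw [le_div_iff₀ t2]; linarith
    have c3 := c1.trans (mul_le_mul_of_nonneg_left c2 (norm_nonneg _))
    have c4 := mul_le_mul_of_nonneg_left c3 (by positivity : 0 ≤ 2 * τ (m+1))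
    refine c4.trans ?_
    have c5 := sq_nonneg (‖y (m+1) - y m‖ / Real.sqrt β
      - τ (m+1) / τ (m+2) * μ * ‖x (m+1) - x (m+2)‖)
    have c6 : (‖y (m+1) - y m‖ / Real.sqrt β) ^ 2 = 1 / β * ‖y (m+1) - y m‖ ^ 2 := by
      rw [div_pow, Real.sq_sqrt hβ.le]; ring
    have c7 : 2 * τ (m+1) * (‖y (m+1) - y m‖ * (μ * ‖x (m+1) - x (m+2)‖ / Real.sqrt β / τ (m+2)))
      = 2 * (‖y (m+1) - y m‖ / Real.sqrt β)
        * (τ (m+1) / τ (m+2) * μ * ‖x (m+1) - x (m+2)‖) := by ring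
    rw [c7]
    rw [sub_sq, c6, mul_pow, mul_pow] at c5
    linarith
  have hRR := mul_le_mul_of_nonneg_right hR (sq_nonneg ‖x (m+1) - x (m+2)‖)
  -- y part
  have hyd : y (m+1) - y m = (β * τ (m+1)) • (K (x (m+1)) - w (m+1)) := by
    rw [ey]; abel
  have hY : 2 * τ (m+1) * ⟪y' - y (m+1), K (x (m+1)) - w (m+1)⟫_ℝ =
      1 / β * ‖y' - y m‖ ^ 2 - 1 / β * ‖y' - y (m+1)‖ ^ 2 - 1 / β * ‖y (m+1) - y m‖ ^ 2 := by
    have c := aux_y y' (y (m+1)) (y m)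
    have c2 : ⟪y' - y (m+1), y (m+1) - y m⟫_ℝ
        = β * τ (m+1) * ⟪y' - y (m+1), K (x (m+1)) - w (m+1)⟫_ℝ := by
      rw [hyd, inner_smul_right]
    rw [c2] at c
    have c3 : 2 * τ (m+1) * ⟪y' - y (m+1), K (x (m+1)) - w (m+1)⟫_ℝ
      = 1 / β * (2 * (β * τ (m+1) * ⟪y' - y (m+1), K (x (m+1)) - w (m+1)⟫_ℝ)) := by
      field_simp
    rw [c3, c]; ring
  have ew' := mul_le_mul_of_nonneg_left ew t1.le
  have ehh' := mul_le_mul_of_nonneg_left ehh t1.le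
  rw [norm_sub_rev (x (m+2)) (x (m+1))] at hX
  rw [hwb, sub_self, inner_zero_right]
  simp only [map_sub, inner_sub_left, inner_sub_right, mul_sub, mul_add] at hX ex1 ex3 hG hKp hY ew' ehh' ⊢
  rw [hwb] at ex1
  linarith
end

section
/- Under the P-GRPDA assumptions, the sequence (x_n, y_n) generated by Algorithm 1 converges to a pair (x̃, ỹ) ∈ X × Y such that (x̃, Kx̃, ỹ) is a saddle point of the Lagrangian 𝓛. -/
open Filter Topology

local notation "⟪" x ", " y "⟫_ℝ" => @inner ℝ _ _ x y

theorem pg_three {X : Type*} [NormedAddCommGroup X] [InnerProductSpace ℝ X] (a b c : X) :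
    2 * ⟪a - b, c - a⟫_ℝ = ‖b - c‖^2 - ‖a - c‖^2 - ‖a - b‖^2 := by
  have h : b - c = (b - a) + (a - c) := by abel
  have := norm_add_sq_real (b - a) (a - c)
  rw [h, this, norm_sub_rev b a]
  have : ⟪b - a, a - c⟫_ℝ = ⟪a - b, c - a⟫_ℝ := by
    rw [← neg_sub a b, ← neg_sub c a, inner_neg_neg]
  linarith

theorem pg_comb {X : Type*} [NormedAddCommGroup X] [InnerProductSpace ℝ X] (x z z' c : X) (ψ : ℝ)
    (hψ : 1 < ψ) (hz : z' = ((ψ - 1) / ψ) • x + (1 / ψ) • z) :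
    ‖x - c‖^2 = ψ / (ψ - 1) * ‖z' - c‖^2 - (ψ / (ψ - 1) - 1) * ‖z - c‖^2 + (1/ψ) * ‖x - z‖^2 := by
  have h0 : ψ ≠ 0 := by linarith
  have h1 : ψ - 1 ≠ 0 := by linarith
  have e1 : z' - c = ((ψ - 1) / ψ) • (x - c) + (1/ψ) • (z - c) := by
    rw [hz]
    match_scalars <;> field_simp
    ring
  have e2 : x - z = (x - c) - (z - c) := by abel
  rw [e1, e2, norm_add_sq_real, norm_sub_sq_real (x - c) (z - c), norm_smul, norm_smul, inner_smul_left,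
    inner_smul_right]
  simp only [mul_pow, Real.norm_eq_abs, sq_abs, conj_trivial]
  field_simp
  ring

theorem pg_grad {X : Type*} [NormedAddCommGroup X] [InnerProductSpace ℝ X] [CompleteSpace X]
    (h : X → ℝ) (G : X) (a b : X) (hh : ConvexOn ℝ Set.univ h) (hG : HasGradientAt h G a) :
    ⟪G, b - a⟫_ℝ ≤ h b - h a := by
  have hl : HasDerivAt (fun t : ℝ => h (a + t • (b - a))) ⟪G, b - a⟫_ℝ 0 := by
    have h1 : HasDerivAt (fun t : ℝ => a + t • (b - a)) (b - a) 0 := by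
      simpa using ((hasDerivAt_id (0:ℝ)).smul_const (b - a)).const_add a
    have h2 : HasFDerivAt h (InnerProductSpace.toDual ℝ X G) (a + (0:ℝ) • (b - a)) := by
      simpa using hG.hasFDerivAt
    have h3 := h2.comp_hasDerivAt 0 h1
    rw [InnerProductSpace.toDual_apply_apply] at h3
    exact h3
  have hc : ConvexOn ℝ Set.univ (fun t : ℝ => h (a + t • (b - a))) := by
    have := hh.comp_affineMap (AffineMap.lineMap a b : ℝ →ᵃ[ℝ] X)
    simpa [Function.comp_def, AffineMap.lineMap_apply, add_comm] using this
  have := hc.le_slope_of_hasDerivAt (Set.mem_univ 0) (Set.mem_univ 1) one_pos hl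
  simpa [slope_def_field] using this

theorem pg_step {X Y : Type*}
    [NormedAddCommGroup X] [InnerProductSpace ℝ X] [FiniteDimensional ℝ X]
    [NormedAddCommGroup Y] [InnerProductSpace ℝ Y] [FiniteDimensional ℝ Y]
    (K : X →L[ℝ] Y) (f : X → ℝ) (g : Y → ℝ) (h : X → ℝ) (Gh : X → X)
    (hh : ConvexOn ℝ Set.univ h)
    (hGh : ∀ a : X, HasGradientAt h (Gh a) a)
    (ψ β μ μ' : ℝ) (hψ1 : 1 < ψ) (hψφ : ψ ≤ 1 + 1 / ψ) (hβ : 0 < β) (hμ : 0 ≤ μ) (hμ' : 0 ≤ μ')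
    (xb : X) (yb : Y)
    (hs : ∀ (x' : X) (w' : Y), f xb + h xb + g (K xb) ≤ f x' + h x' + g w' + ⟪yb, K x' - w'⟫_ℝ)
    (x0 x1 x2 z1 z2 z3 : X) (w1 y0 y1 : Y) (t0 t1 t2 : ℝ)
    (ht0 : 0 < t0) (ht1 : 0 < t1) (ht2 : 0 < t2) (ht : t1 ≤ t0)
    (hz2 : z2 = ((ψ - 1) / ψ) • x1 + (1 / ψ) • z1)
    (hz3 : z3 = ((ψ - 1) / ψ) • x2 + (1 / ψ) • z2)
    (hx1 : ∀ u : X, t0 * (f x1 - f u) ≤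
      ⟪x1 - z1 + t0 • (ContinuousLinearMap.adjoint K) y0 + t0 • Gh x0, u - x1⟫_ℝ)
    (hx2 : ∀ u : X, t1 * (f x2 - f u) ≤
      ⟪x2 - z2 + t1 • (ContinuousLinearMap.adjoint K) y1 + t1 • Gh x1, u - x2⟫_ℝ)
    (hw : ∀ v : Y, g w1 - g v ≤ ⟪y1, w1 - v⟫_ℝ)
    (hy : y1 = y0 + (β * t1) • (K x1 - w1))
    (hG : t1 * ‖Gh x1 - Gh x0‖ ≤ μ' * ‖x1 - x0‖)
    (hK : t2 * ‖K (x2 - x1)‖ ≤ μ / Real.sqrt β * ‖x2 - x1‖) :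
    ψ / (ψ - 1) * ‖z3 - xb‖^2 + 1 / β * ‖y1 - yb‖^2 + μ' * ‖x2 - x1‖^2
      + (ψ * (t1 / t0) - μ * (t1 / t2) - 2 * μ') * ‖x2 - x1‖^2
      + (1 - μ * (t1 / t2)) / β * ‖y1 - y0‖^2 + ψ * (t1 / t0) * ‖x1 - z2‖^2
      ≤ ψ / (ψ - 1) * ‖z2 - xb‖^2 + 1 / β * ‖y0 - yb‖^2 + μ' * ‖x1 - x0‖^2 := by
  have h0 : ψ ≠ 0 := by linarith
  have h1 : ψ - 1 ≠ 0 := by linarith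
  -- primal terms
  have A1 := hx2 xb
  have A2 := hx1 x2
  have e1 : x1 - z1 = ψ • (x1 - z2) := by
    rw [hz2]; match_scalars <;> field_simp
    ring
  rw [e1] at A2
  have A2' : t1 * (f x1 - f x2) ≤ ψ * (t1 / t0) * ⟪x1 - z2, x2 - x1⟫_ℝ
      + t1 * ⟪y0, K (x2 - x1)⟫_ℝ + t1 * ⟪Gh x0, x2 - x1⟫_ℝ := by
    have := mul_le_mul_of_nonneg_left A2 (div_pos ht1 ht0).le
    simp only [inner_add_left, inner_smul_left, conj_trivial,
      ContinuousLinearMap.adjoint_inner_left] at this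
    calc _ = t1 / t0 * (t0 * (f x1 - f x2)) := by field_simp
      _ ≤ _ := this
      _ = _ := by field_simp
  simp only [inner_add_left, inner_smul_left, conj_trivial,
      ContinuousLinearMap.adjoint_inner_left] at A1
  have B1 := pg_three x2 z2 xb
  have B2 := pg_three x1 z2 x2
  have B3 := pg_comb x2 z2 z3 xb ψ hψ1 hz3
  have B4 := pg_three y1 y0 yb
  have G1 := pg_grad h (Gh x1) x1 xb hh (hGh x1)
  have D1 := hw (K xb)
  have S1 := hs x1 w1
  have e2 : ⟪y1 - y0, yb - y1⟫_ℝ = β * (t1 * ⟪K x1 - w1, yb - y1⟫_ℝ) := by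
    have : y1 - y0 = (β * t1) • (K x1 - w1) := by rw [hy]; abel
    rw [this, inner_smul_left, conj_trivial]; ring
  have hr : 0 < Real.sqrt β := Real.sqrt_pos.2 hβ
  have C1 : t1 * ⟪y1 - y0, K (x1 - x2)⟫_ℝ * 2 ≤
      μ * (t1 / t2) * (1 / β * ‖y1 - y0‖^2 + ‖x2 - x1‖^2) := by
    have a1 := real_inner_le_norm (y1 - y0) (K (x1 - x2))
    have a2 : ‖K (x1 - x2)‖ = ‖K (x2 - x1)‖ := by
      rw [← neg_sub, map_neg, norm_neg]
    rw [a2] at a1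
    have a3 : ‖K (x2 - x1)‖ ≤ (μ / t2) * (‖x2 - x1‖ / Real.sqrt β) := by
      rw [div_mul_div_comm, le_div_iff₀ (by positivity)]
      have := mul_le_mul_of_nonneg_right hK hr.le
      have e : μ / Real.sqrt β * ‖x2 - x1‖ * Real.sqrt β = μ * ‖x2 - x1‖ := by field_simp
      linarith
    have a4 : ⟪y1 - y0, K (x1 - x2)⟫_ℝ ≤ ‖y1 - y0‖ * ((μ / t2) * (‖x2 - x1‖ / Real.sqrt β)) :=
      a1.trans (mul_le_mul_of_nonneg_left a3 (norm_nonneg _))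
    have a5 : 2 * (‖y1 - y0‖ / Real.sqrt β) * ‖x2 - x1‖ ≤ (‖y1 - y0‖ / Real.sqrt β)^2 + ‖x2 - x1‖^2 :=
      two_mul_le_add_sq _ _
    rw [div_pow, Real.sq_sqrt hβ.le] at a5
    calc _ ≤ t1 * (‖y1 - y0‖ * ((μ / t2) * (‖x2 - x1‖ / Real.sqrt β))) * 2 := by gcongr
      _ = μ * (t1 / t2) * (2 * (‖y1 - y0‖ / Real.sqrt β) * ‖x2 - x1‖) := by ring
      _ ≤ μ * (t1 / t2) * (‖y1 - y0‖^2 / β + ‖x2 - x1‖^2) := by gcongr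
      _ = _ := by ring
  have C2 : t1 * ⟪Gh x1 - Gh x0, x1 - x2⟫_ℝ * 2 ≤ μ' * (‖x1 - x0‖^2 + ‖x2 - x1‖^2) := by
    have a1 := real_inner_le_norm (Gh x1 - Gh x0) (x1 - x2)
    rw [norm_sub_rev x1 x2] at a1
    have a5 := two_mul_le_add_sq ‖x1 - x0‖ ‖x2 - x1‖
    calc _ ≤ t1 * (‖Gh x1 - Gh x0‖ * ‖x2 - x1‖) * 2 := by gcongr
      _ = (t1 * ‖Gh x1 - Gh x0‖) * ‖x2 - x1‖ * 2 := by ring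
      _ ≤ (μ' * ‖x1 - x0‖) * ‖x2 - x1‖ * 2 := by gcongr
      _ = μ' * (2 * ‖x1 - x0‖ * ‖x2 - x1‖) := by ring
      _ ≤ _ := by gcongr
  have hd : t1 / t0 ≤ 1 := (div_le_one ht0).2 ht
  have F1 : 0 ≤ (1 + 1 / ψ - ψ * (t1 / t0)) * ‖x2 - z2‖^2 := by
    apply mul_nonneg _ (sq_nonneg _)
    nlinarith
  have e3 : t1 * ⟪K x1 - w1, yb - y1⟫_ℝ = 1 / β * ⟪y1 - y0, yb - y1⟫_ℝ := by
    rw [e2]; field_simp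
  -- combine
  have G1' := mul_le_mul_of_nonneg_left G1 ht1.le
  have D1' := mul_le_mul_of_nonneg_left D1 ht1.le
  have S1' := mul_le_mul_of_nonneg_left S1 ht1.le
  have B2' := congrArg (fun r => ψ * (t1 / t0) * r) B2
  have B4' := congrArg (fun r => 1 / β * r) B4
  have EK : ⟪y1, K (xb - x2)⟫_ℝ + ⟪y0, K (x2 - x1)⟫_ℝ
      = ⟪y1, K xb - K x1⟫_ℝ + ⟪y1 - y0, K (x1 - x2)⟫_ℝ := by
    simp only [map_sub, inner_sub_right, inner_sub_left]; ring
  have Eh : ⟪Gh x1, xb - x2⟫_ℝ + ⟪Gh x0, x2 - x1⟫_ℝ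
      = ⟪Gh x1, xb - x1⟫_ℝ + ⟪Gh x1 - Gh x0, x1 - x2⟫_ℝ := by
    simp only [inner_sub_right, inner_sub_left]; ring
  have Ew : ⟪K x1 - w1, yb - y1⟫_ℝ = ⟪yb, K x1 - w1⟫_ℝ - ⟪y1, K x1 - w1⟫_ℝ := by
    rw [real_inner_comm, inner_sub_left]
  have Ev : ⟪y1, w1 - K xb⟫_ℝ + ⟪y1, K xb - K x1⟫_ℝ = - ⟪y1, K x1 - w1⟫_ℝ := by
    simp only [inner_sub_right]; ring
  have EK' := congrArg (fun r => t1 * r) EK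
  have Eh' := congrArg (fun r => t1 * r) Eh
  have Ew' := congrArg (fun r => t1 * r) Ew
  have Ev' := congrArg (fun r => t1 * r) Ev
  rw [norm_sub_rev z2 x2, norm_sub_rev x1 x2] at B2'
  clear hx1 hx2 hw hs hGh hh A2 G1 D1 S1 B2 B4 EK Eh Ew Ev e2 hG hK e1 hz2 hz3 hy
  linear_combination 2 * A1 + 2 * A2' + 2 * G1' + 2 * D1' + 2 * S1' + C1 + C2 + F1 + B1 - B3 + B2'
    + B4' + 2 * EK' + 2 * Eh' + 2 * e3 - 2 * Ew' + 2 * Ev'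

theorem pg_seq (V D : ℕ → ℝ) (ε : ℝ) (N : ℕ) (hε : 0 < ε) (hV : ∀ n, 0 ≤ V n) (hD : ∀ n, 0 ≤ D n)
    (h : ∀ n, N ≤ n → V (n + 1) + ε * D n ≤ V n) :
    ∃ l, Tendsto V atTop (𝓝 l) ∧ Tendsto D atTop (𝓝 0) := by
  have hanti : Antitone (fun k => V (k + N)) := by
    apply antitone_nat_of_succ_le
    intro k
    have := h (k + N) (by omega)
    have h2 := mul_nonneg hε.le (hD (k + N))
    have e : k + 1 + N = k + N + 1 := by omega
    rw [e]; linarith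
  have hl := tendsto_atTop_ciInf hanti ⟨0, by rintro _ ⟨k, rfl⟩; exact hV _⟩
  have hV' := (tendsto_add_atTop_iff_nat N).1 hl
  refine ⟨_, hV', ?_⟩
  have hV1 := (tendsto_add_atTop_iff_nat 1).2 hV'
  have hd : Tendsto (fun n => (V n - V (n + 1)) / ε) atTop (𝓝 0) := by
    simpa using (hV'.sub hV1).div_const ε
  refine tendsto_of_tendsto_of_tendsto_of_le_of_le' tendsto_const_nhds hd
    (Eventually.of_forall hD) ?_
  filter_upwards [eventually_ge_atTop N] with n hn
  rw [le_div_iff₀ hε]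
  have := h n hn
  linarith

theorem pg_sq {X : Type*} [NormedAddCommGroup X] (a : ℕ → X)
    (h : Tendsto (fun n => ‖a n‖^2) atTop (𝓝 0)) : Tendsto a atTop (𝓝 0) := by
  rw [tendsto_zero_iff_norm_tendsto_zero]
  have := h.sqrt
  simpa using this

theorem pgrpda_global_convergence {X Y : Type*}
    [NormedAddCommGroup X] [InnerProductSpace ℝ X] [FiniteDimensional ℝ X]
    [NormedAddCommGroup Y] [InnerProductSpace ℝ Y] [FiniteDimensional ℝ Y]
    (K : X →L[ℝ] Y) (hK : K ≠ 0)
    (f : X → ℝ) (g : Y → ℝ) (h : X → ℝ) (Gh : X → X)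
    (hf : ConvexOn ℝ Set.univ f) (hg : ConvexOn ℝ Set.univ g)
    (hh : ConvexOn ℝ Set.univ h)
    (hGh : ∀ a : X, HasGradientAt h (Gh a) a)
    (L : ℝ) (hL : 0 < L) (hLip : ∀ a b : X, ‖Gh a - Gh b‖ ≤ L * ‖a - b‖)
    (ψ β μ μ' : ℝ) (hψ1 : 1 < ψ) (hψφ : ψ ≤ (1 + Real.sqrt 5) / 2)
    (hβ : 0 < β) (hμ'0 : 0 < μ') (hμμ' : 2 * μ' < μ) (hμψ : μ < ψ / 2)
    (xb : X) (wb yb : Y)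
    (hsaddle : ∀ (x' : X) (w' y' : Y),
      f xb + h xb + g wb + ⟪y', K xb - wb⟫_ℝ ≤
          f xb + h xb + g wb + ⟪yb, K xb - wb⟫_ℝ ∧
        f xb + h xb + g wb + ⟪yb, K xb - wb⟫_ℝ ≤
          f x' + h x' + g w' + ⟪yb, K x' - w'⟫_ℝ)
    (x z : ℕ → X) (w y : ℕ → Y) (τ : ℕ → ℝ)
    (hτ0 : 0 < τ 0) (hz0 : z 0 = x 0)
    (hz : ∀ n, 1 ≤ n → z n = ((ψ - 1) / ψ) • x (n - 1) + (1 / ψ) • z (n - 1))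
    (hx : ∀ n, 1 ≤ n → ∀ u : X,
      τ (n - 1) * (f (x n) - f u) ≤
        ⟪x n - z n + τ (n - 1) • (ContinuousLinearMap.adjoint K) (y (n - 1))
            + τ (n - 1) • Gh (x (n - 1)), u - x n⟫_ℝ)
    (hτ : ∀ n, 1 ≤ n → τ n = min (τ (n - 1)) (min
        (if ‖K (x n - x (n - 1))‖ = 0 then τ (n - 1)
          else μ * ‖x n - x (n - 1)‖ / (Real.sqrt β * ‖K (x n - x (n - 1))‖))
        (if ‖Gh (x n) - Gh (x (n - 1))‖ = 0 then τ (n - 1)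
          else μ' * ‖x n - x (n - 1)‖ / ‖Gh (x n) - Gh (x (n - 1))‖)))
    (hw : ∀ n, 1 ≤ n → ∀ v : Y,
      g (w n) - g v ≤ ⟪y (n - 1) + (β * τ n) • (K (x n) - w n), w n - v⟫_ℝ)
    (hy : ∀ n, 1 ≤ n → y n = y (n - 1) + (β * τ n) • (K (x n) - w n)) :
    ∃ (xt : X) (yt : Y),
      Filter.Tendsto (fun n => (x n, y n)) Filter.atTop (nhds (xt, yt)) ∧
      (∀ y' : Y, f xt + h xt + g (K xt) + ⟪y', K xt - K xt⟫_ℝ ≤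
          f xt + h xt + g (K xt) + ⟪yt, K xt - K xt⟫_ℝ) ∧
      (∀ (x' : X) (w' : Y), f xt + h xt + g (K xt) + ⟪yt, K xt - K xt⟫_ℝ ≤
          f x' + h x' + g w' + ⟪yt, K x' - w'⟫_ℝ) := by
  have hμ0 : 0 < μ := by linarith
  have hψ0 : 0 < ψ := by linarith
  have h5 : Real.sqrt 5 ^ 2 = 5 := Real.sq_sqrt (by norm_num)
  have hψsq : ψ * ψ ≤ ψ + 1 := by
    nlinarith [Real.sqrt_nonneg 5]
  have hψ' : ψ ≤ 1 + 1 / ψ := by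
    rw [← sub_nonneg]
    have : 1 + 1 / ψ - ψ = (ψ + 1 - ψ * ψ) / ψ := by field_simp
    rw [this]
    exact div_nonneg (by linarith) hψ0.le
  have hψ2 : ψ < 2 := by nlinarith
  have hs : 0 < Real.sqrt β := Real.sqrt_pos.2 hβ
  have hKn : 0 < ‖K‖ := norm_pos_iff.2 hK
  -- shifted forms
  have hz' : ∀ n, z (n + 1) = ((ψ - 1) / ψ) • x n + (1 / ψ) • z n := fun n => hz (n + 1) (by omega)
  have hx' : ∀ n, ∀ u : X, τ n * (f (x (n + 1)) - f u) ≤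
        ⟪x (n + 1) - z (n + 1) + τ n • (ContinuousLinearMap.adjoint K) (y n)
            + τ n • Gh (x n), u - x (n + 1)⟫_ℝ := fun n => hx (n + 1) (by omega)
  have hτ' : ∀ n, τ (n + 1) = min (τ n) (min
        (if ‖K (x (n + 1) - x n)‖ = 0 then τ n
          else μ * ‖x (n + 1) - x n‖ / (Real.sqrt β * ‖K (x (n + 1) - x n)‖))
        (if ‖Gh (x (n + 1)) - Gh (x n)‖ = 0 then τ n
          else μ' * ‖x (n + 1) - x n‖ / ‖Gh (x (n + 1)) - Gh (x n)‖)) :=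
    fun n => hτ (n + 1) (by omega)
  have hy' : ∀ n, y (n + 1) = y n + (β * τ (n + 1)) • (K (x (n + 1)) - w (n + 1)) :=
    fun n => hy (n + 1) (by omega)
  have hw' : ∀ n, ∀ v : Y, g (w (n + 1)) - g v ≤ ⟪y (n + 1), w (n + 1) - v⟫_ℝ := by
    intro n v
    rw [hy' n]
    exact hw (n + 1) (by omega) v
  -- step sizes
  have T1 : ∀ n, τ (n + 1) ≤ τ n := fun n => by rw [hτ' n]; exact min_le_left _ _
  obtain ⟨c, hc, T2⟩ : ∃ c, 0 < c ∧ ∀ n, c ≤ τ n := by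
    refine ⟨min (τ 0) (min (μ / (Real.sqrt β * ‖K‖)) (μ' / L)), by positivity, ?_⟩
    intro n
    induction n with
    | zero => exact min_le_left _ _
    | succ n ih =>
      rw [hτ' n]
      refine le_min ih (le_min ?_ ?_)
      · split_ifs with h0
        · exact ih
        · refine ((min_le_right _ _).trans (min_le_left _ _)).trans ?_
          have hp : 0 < ‖K (x (n + 1) - x n)‖ := lt_of_le_of_ne (norm_nonneg _) (Ne.symm h0)
          have := K.le_opNorm (x (n + 1) - x n)
          rw [div_le_div_iff₀ (by positivity) (by positivity)]
          calc μ * (Real.sqrt β * ‖K (x (n + 1) - x n)‖)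
              ≤ μ * (Real.sqrt β * (‖K‖ * ‖x (n + 1) - x n‖)) := by gcongr
            _ = _ := by ring
      · split_ifs with h0
        · exact ih
        · refine ((min_le_right _ _).trans (min_le_right _ _)).trans ?_
          have hp : 0 < ‖Gh (x (n + 1)) - Gh (x n)‖ := lt_of_le_of_ne (norm_nonneg _) (Ne.symm h0)
          have := hLip (x (n + 1)) (x n)
          rw [div_le_div_iff₀ (by positivity) (by positivity)]
          calc μ' * ‖Gh (x (n + 1)) - Gh (x n)‖
              ≤ μ' * (L * ‖x (n + 1) - x n‖) := by gcongr
            _ = _ := by ring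
  have Tp : ∀ n, 0 < τ n := fun n => hc.trans_le (T2 n)
  have T3 : ∀ n, τ (n + 1) * ‖K (x (n + 1) - x n)‖ ≤ μ / Real.sqrt β * ‖x (n + 1) - x n‖ := by
    intro n
    by_cases h0 : ‖K (x (n + 1) - x n)‖ = 0
    · rw [h0, mul_zero]; positivity
    · have hp : 0 < ‖K (x (n + 1) - x n)‖ := lt_of_le_of_ne (norm_nonneg _) (Ne.symm h0)
      have : τ (n + 1) ≤ μ * ‖x (n + 1) - x n‖ / (Real.sqrt β * ‖K (x (n + 1) - x n)‖) := by
        rw [hτ' n, if_neg h0]; exact (min_le_right _ _).trans (min_le_left _ _)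
      calc _ ≤ μ * ‖x (n + 1) - x n‖ / (Real.sqrt β * ‖K (x (n + 1) - x n)‖)
            * ‖K (x (n + 1) - x n)‖ := by gcongr
        _ = _ := by field_simp
  have T4 : ∀ n, τ (n + 1) * ‖Gh (x (n + 1)) - Gh (x n)‖ ≤ μ' * ‖x (n + 1) - x n‖ := by
    intro n
    by_cases h0 : ‖Gh (x (n + 1)) - Gh (x n)‖ = 0
    · rw [h0, mul_zero]; positivity
    · have hp : 0 < ‖Gh (x (n + 1)) - Gh (x n)‖ := lt_of_le_of_ne (norm_nonneg _) (Ne.symm h0)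
      have : τ (n + 1) ≤ μ' * ‖x (n + 1) - x n‖ / ‖Gh (x (n + 1)) - Gh (x n)‖ := by
        rw [hτ' n, if_neg h0]; exact (min_le_right _ _).trans (min_le_right _ _)
      rwa [le_div_iff₀ hp] at this
  obtain ⟨ts, hts, hτl⟩ : ∃ ts, 0 < ts ∧ Tendsto τ atTop (𝓝 ts) := by
    have := tendsto_atTop_ciInf (antitone_nat_of_succ_le T1)
      ⟨c, by rintro _ ⟨k, rfl⟩; exact T2 _⟩
    exact ⟨_, hc.trans_le (ge_of_tendsto' this T2), this⟩
  have hτ1 := (tendsto_add_atTop_iff_nat 1).2 hτl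
  have hτ2 := (tendsto_add_atTop_iff_nat 2).2 hτl
  have hδ : Tendsto (fun n => τ (n + 1) / τ n) atTop (𝓝 1) := by
    have := hτ1.div hτl hts.ne'
    rw [div_self hts.ne'] at this
    exact this
  have hρ : Tendsto (fun n => τ (n + 1) / τ (n + 2)) atTop (𝓝 1) := by
    have := hτ1.div hτ2 hts.ne'
    rw [div_self hts.ne'] at this
    exact this
  obtain ⟨ε, hε, hev⟩ : ∃ ε, 0 < ε ∧ ∀ᶠ n in atTop,
      ε ≤ ψ * (τ (n + 1) / τ n) - μ * (τ (n + 1) / τ (n + 2)) - 2 * μ' ∧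
      ε ≤ (1 - μ * (τ (n + 1) / τ (n + 2))) / β ∧ ε ≤ ψ * (τ (n + 1) / τ n) := by
    have a1 : Tendsto (fun n => ψ * (τ (n + 1) / τ n) - μ * (τ (n + 1) / τ (n + 2)) - 2 * μ')
        atTop (𝓝 (ψ * 1 - μ * 1 - 2 * μ')) :=
      ((hδ.const_mul ψ).sub (hρ.const_mul μ)).sub_const _
    have a2 : Tendsto (fun n => (1 - μ * (τ (n + 1) / τ (n + 2))) / β)
        atTop (𝓝 ((1 - μ * 1) / β)) := ((hρ.const_mul μ).const_sub 1).div_const β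
    have a3 : Tendsto (fun n => ψ * (τ (n + 1) / τ n)) atTop (𝓝 (ψ * 1)) := hδ.const_mul ψ
    have p1 : 0 < ψ * 1 - μ * 1 - 2 * μ' := by linarith
    have p2 : 0 < (1 - μ * 1) / β := div_pos (by linarith) hβ
    have p3 : 0 < ψ * 1 := by linarith
    obtain ⟨ε, hε, hε'⟩ := exists_between (lt_min p1 (lt_min p2 p3))
    refine ⟨ε, hε, ?_⟩
    rw [lt_min_iff, lt_min_iff] at hε'
    filter_upwards [a1.eventually_const_lt hε'.1, a2.eventually_const_lt hε'.2.1,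
      a3.eventually_const_lt hε'.2.2] with n h1 h2 h3
    exact ⟨h1.le, h2.le, h3.le⟩
  obtain ⟨N, hN⟩ := eventually_atTop.1 hev
  set D : ℕ → ℝ := fun n => ‖x (n + 2) - x (n + 1)‖^2 + ‖y (n + 1) - y n‖^2
    + ‖x (n + 1) - z (n + 2)‖^2 with hDdef
  have hψψ : 1 ≤ ψ / (ψ - 1) := by rw [le_div_iff₀ (by linarith)]; linarith
  have key : ∀ (xs : X) (ys : Y),
      (∀ (x' : X) (w' : Y), f xs + h xs + g (K xs) ≤ f x' + h x' + g w' + ⟪ys, K x' - w'⟫_ℝ) →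
      ∃ l, Tendsto (fun n => ψ / (ψ - 1) * ‖z (n + 2) - xs‖^2 + 1 / β * ‖y n - ys‖^2
        + μ' * ‖x (n + 1) - x n‖^2) atTop (𝓝 l) ∧ Tendsto D atTop (𝓝 0) := by
    intro xs ys hsad
    refine pg_seq _ D ε N hε (fun n => ?_) (fun n => ?_) (fun n hn => ?_)
    · have : 0 ≤ ψ / (ψ - 1) := by linarith
      positivity
    · positivity
    · have st := pg_step K f g h Gh hh hGh ψ β μ μ' hψ1 hψ' hβ hμ0.le hμ'0.le xs ys hsad
        (x n) (x (n + 1)) (x (n + 2)) (z (n + 1)) (z (n + 2)) (z (n + 3)) (w (n + 1))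
        (y n) (y (n + 1)) (τ n) (τ (n + 1)) (τ (n + 2)) (Tp _) (Tp _) (Tp _) (T1 n)
        (hz' _) (hz' _) (hx' n) (hx' (n + 1)) (hw' n) (hy' n) (T4 n) (T3 (n + 1))
      obtain ⟨q1, q2, q3⟩ := hN n hn
      have r1 := mul_le_mul_of_nonneg_right q1 (sq_nonneg ‖x (n + 2) - x (n + 1)‖)
      have r2 := mul_le_mul_of_nonneg_right q2 (sq_nonneg ‖y (n + 1) - y n‖)
      have r3 := mul_le_mul_of_nonneg_right q3 (sq_nonneg ‖x (n + 1) - z (n + 2)‖)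
      have e : n + 1 + 2 = n + 3 := rfl
      have e' : n + 1 + 1 = n + 2 := rfl
      simp only [hDdef, e, e']
      linarith
  -- the given saddle point
  have hwb : K xb = wb := by
    have h1 := (hsaddle xb wb (yb + (K xb - wb))).1
    rw [inner_add_left] at h1
    have h2 : ⟪K xb - wb, K xb - wb⟫_ℝ ≤ 0 := by linarith
    rw [real_inner_self_eq_norm_sq] at h2
    have h3 : ‖K xb - wb‖ = 0 := by nlinarith [norm_nonneg (K xb - wb)]
    exact sub_eq_zero.1 (norm_eq_zero.1 h3)
  have hsadb : ∀ (x' : X) (w' : Y),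
      f xb + h xb + g (K xb) ≤ f x' + h x' + g w' + ⟪yb, K x' - w'⟫_ℝ := by
    intro x' w'
    have := (hsaddle x' w' yb).2
    rw [hwb, sub_self, inner_zero_right, add_zero] at this
    rw [hwb]; exact this
  obtain ⟨l, hVl, hD0⟩ := key xb yb hsadb
  have Dx : Tendsto (fun n => x (n + 2) - x (n + 1)) atTop (𝓝 0) := by
    refine pg_sq _ (squeeze_zero (fun n => by positivity) (fun n => ?_) hD0)
    simp only [hDdef]
    nlinarith [sq_nonneg ‖y (n + 1) - y n‖, sq_nonneg ‖x (n + 1) - z (n + 2)‖]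
  have Dy : Tendsto (fun n => y (n + 1) - y n) atTop (𝓝 0) := by
    refine pg_sq _ (squeeze_zero (fun n => by positivity) (fun n => ?_) hD0)
    simp only [hDdef]
    nlinarith [sq_nonneg ‖x (n + 2) - x (n + 1)‖, sq_nonneg ‖x (n + 1) - z (n + 2)‖]
  have Dz : Tendsto (fun n => x (n + 1) - z (n + 2)) atTop (𝓝 0) := by
    refine pg_sq _ (squeeze_zero (fun n => by positivity) (fun n => ?_) hD0)
    simp only [hDdef]
    nlinarith [sq_nonneg ‖x (n + 2) - x (n + 1)‖, sq_nonneg ‖y (n + 1) - y n‖]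
  obtain ⟨M, hM⟩ := hVl.bddAbove_range
  have hM' : ∀ n, ψ / (ψ - 1) * ‖z (n + 2) - xb‖^2 + 1 / β * ‖y n - yb‖^2
        + μ' * ‖x (n + 1) - x n‖^2 ≤ M := fun n => hM ⟨n, rfl⟩
  obtain ⟨⟨xt, yt⟩, -, φ, hφ, hlim⟩ := tendsto_subseq_of_bounded
    (s := Metric.closedBall xb (Real.sqrt M) ×ˢ Metric.closedBall yb (Real.sqrt (β * M)))
    (Metric.isBounded_closedBall.prod Metric.isBounded_closedBall)
    (x := fun n => (z (n + 2), y n)) (by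
      intro n
      have hn := hM' n
      have b1 : 0 ≤ 1 / β * ‖y n - yb‖^2 := by positivity
      have b2 : 0 ≤ μ' * ‖x (n + 1) - x n‖^2 := by positivity
      have b3 : ‖z (n + 2) - xb‖^2 ≤ ψ / (ψ - 1) * ‖z (n + 2) - xb‖^2 :=
        le_mul_of_one_le_left (sq_nonneg _) hψψ
      have b4 := sq_nonneg ‖z (n + 2) - xb‖
      refine ⟨?_, ?_⟩
      · rw [Metric.mem_closedBall, dist_eq_norm]
        apply Real.le_sqrt_of_sq_le
        linarith
      · rw [Metric.mem_closedBall, dist_eq_norm]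
        apply Real.le_sqrt_of_sq_le
        have : 1 / β * ‖y n - yb‖^2 ≤ M := by linarith
        calc ‖y n - yb‖^2 = β * (1 / β * ‖y n - yb‖^2) := by field_simp
          _ ≤ _ := by gcongr)
  have hφt := hφ.tendsto_atTop
  have Lz : Tendsto (fun k => z (φ k + 2)) atTop (𝓝 xt) := (continuous_fst.tendsto _).comp hlim
  have Ly : Tendsto (fun k => y (φ k)) atTop (𝓝 yt) := (continuous_snd.tendsto _).comp hlim
  have Lx1 : Tendsto (fun k => x (φ k + 1)) atTop (𝓝 xt) := by
    simpa using (Dz.comp hφt).add Lz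
  have Lx2 : Tendsto (fun k => x (φ k + 2)) atTop (𝓝 xt) := by
    simpa using (Dx.comp hφt).add Lx1
  have Ly1 : Tendsto (fun k => y (φ k + 1)) atTop (𝓝 yt) := by
    simpa using (Dy.comp hφt).add Ly
  have Lt1 : Tendsto (fun k => τ (φ k + 1)) atTop (𝓝 ts) := hτ1.comp hφt
  have KL : Tendsto (fun k => K (x (φ k + 1))) atTop (𝓝 (K xt)) := (K.continuous.tendsto _).comp Lx1
  have Lw : Tendsto (fun k => w (φ k + 1)) atTop (𝓝 (K xt)) := by
    have e : ∀ k, w (φ k + 1) = K (x (φ k + 1))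
        - (β * τ (φ k + 1))⁻¹ • (y (φ k + 1) - y (φ k)) := by
      intro k
      have hne : β * τ (φ k + 1) ≠ 0 := (mul_pos hβ (Tp _)).ne'
      rw [hy' (φ k), add_sub_cancel_left, smul_smul, inv_mul_cancel₀ hne, one_smul]
      abel
    simp_rw [e]
    have i1 : Tendsto (fun k => (β * τ (φ k + 1))⁻¹) atTop (𝓝 (β * ts)⁻¹) :=
      (Lt1.const_mul β).inv₀ (mul_pos hβ hts).ne'
    have := KL.sub (i1.smul (Dy.comp hφt))
    simpa using this
  have hfc : Continuous f := hf.locallyLipschitz.continuous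
  have hgc : Continuous g := hg.locallyLipschitz.continuous
  have hGc : Continuous Gh := by
    have : LipschitzWith ⟨L, hL.le⟩ Gh := LipschitzWith.of_dist_le_mul (fun a b => by
      rw [dist_eq_norm, dist_eq_norm]; exact hLip a b)
    exact this.continuous
  have Sf : ∀ u, ts * (f xt - f u) ≤
      ⟪ts • (ContinuousLinearMap.adjoint K) yt + ts • Gh xt, u - xt⟫_ℝ := by
    intro u
    have l1 : Tendsto (fun k => τ (φ k + 1) * (f (x (φ k + 2)) - f u)) atTop
        (𝓝 (ts * (f xt - f u))) := Lt1.mul (((hfc.tendsto _).comp Lx2).sub_const _)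
    have l2 : Tendsto (fun k => ⟪x (φ k + 2) - z (φ k + 2)
        + τ (φ k + 1) • (ContinuousLinearMap.adjoint K) (y (φ k + 1))
        + τ (φ k + 1) • Gh (x (φ k + 1)), u - x (φ k + 2)⟫_ℝ) atTop
        (𝓝 ⟪xt - xt + ts • (ContinuousLinearMap.adjoint K) yt + ts • Gh xt, u - xt⟫_ℝ) := by
      refine Tendsto.inner (((Lx2.sub Lz).add (Lt1.smul ?_)).add (Lt1.smul ?_)) (Lx2.const_sub u)
      · exact ((ContinuousLinearMap.adjoint K).continuous.tendsto _).comp Ly1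
      · exact (hGc.tendsto _).comp Lx1
    have := le_of_tendsto_of_tendsto' l1 l2 (fun k => hx' (φ k + 1) u)
    rwa [sub_self, zero_add] at this
  have Sg : ∀ v, g (K xt) - g v ≤ ⟪yt, K xt - v⟫_ℝ := by
    intro v
    exact le_of_tendsto_of_tendsto' (((hgc.tendsto _).comp Lw).sub_const _)
      (Ly1.inner (Lw.sub_const v)) (fun k => hw' (φ k) v)
  have hsadt : ∀ (x' : X) (w' : Y),
      f xt + h xt + g (K xt) ≤ f x' + h x' + g w' + ⟪yt, K x' - w'⟫_ℝ := by
    intro x' w'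
    have a1 := Sf x'
    have a2 := Sg w'
    have a3 := pg_grad h (Gh xt) xt x' hh (hGh xt)
    rw [← smul_add, inner_smul_left, conj_trivial] at a1
    have a4 := le_of_mul_le_mul_left a1 hts
    rw [inner_add_left, ContinuousLinearMap.adjoint_inner_left] at a4
    simp only [map_sub, inner_sub_right] at *
    linarith
  obtain ⟨l', hVl', -⟩ := key xt yt hsadt
  have Dx0 : Tendsto (fun n => x (n + 1) - x n) atTop (𝓝 0) :=
    (tendsto_add_atTop_iff_nat (f := fun n => x (n + 1) - x n) 1).1 Dx
  have hl0 : l' = 0 := by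
    have c1 := hVl'.comp hφt
    have c2 : Tendsto (fun k => ψ / (ψ - 1) * ‖z (φ k + 2) - xt‖^2 + 1 / β * ‖y (φ k) - yt‖^2
        + μ' * ‖x (φ k + 1) - x (φ k)‖^2) atTop
        (𝓝 (ψ / (ψ - 1) * ‖xt - xt‖^2 + 1 / β * ‖yt - yt‖^2 + μ' * ‖(0:X)‖^2)) :=
      ((((Lz.sub_const xt).norm.pow 2).const_mul _).add
        (((Ly.sub_const yt).norm.pow 2).const_mul _)).add
        (((Dx0.comp hφt).norm.pow 2).const_mul _)
    have := tendsto_nhds_unique c1 c2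
    simpa using this
  rw [hl0] at hVl'
  have Fz : Tendsto (fun n => z (n + 2)) atTop (𝓝 xt) := by
    rw [← tendsto_sub_nhds_zero_iff]
    refine pg_sq _ (squeeze_zero (fun n => by positivity) (fun n => ?_) hVl')
    have b1 : 0 ≤ 1 / β * ‖y n - yt‖^2 := by positivity
    have b2 : 0 ≤ μ' * ‖x (n + 1) - x n‖^2 := by positivity
    have b3 : ‖z (n + 2) - xt‖^2 ≤ ψ / (ψ - 1) * ‖z (n + 2) - xt‖^2 :=
      le_mul_of_one_le_left (sq_nonneg _) hψψ
    linarith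
  have Fy : Tendsto y atTop (𝓝 yt) := by
    rw [← tendsto_sub_nhds_zero_iff]
    have hV2 := hVl'.const_mul β
    rw [mul_zero] at hV2
    refine pg_sq _ (squeeze_zero (fun n => by positivity) (fun n => ?_) hV2)
    have b2 : 0 ≤ μ' * ‖x (n + 1) - x n‖^2 := by positivity
    have b3 : 0 ≤ ψ / (ψ - 1) * ‖z (n + 2) - xt‖^2 :=
      mul_nonneg (by linarith) (sq_nonneg _)
    calc ‖y n - yt‖^2 = β * (1 / β * ‖y n - yt‖^2) := by field_simp
      _ ≤ _ := by gcongr; linarith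
  have Fx : Tendsto x atTop (𝓝 xt) := by
    apply (tendsto_add_atTop_iff_nat 1).1
    simpa using Dz.add Fz
  refine ⟨xt, yt, Fx.prodMk_nhds Fy, fun y' => ?_, fun x' w' => ?_⟩
  · simp
  · rw [sub_self, inner_zero_right, add_zero]
    exact hsadt x' w'
end

section
/- Under the P-GRPDA assumptions, for every real number b > 0 with b ≥ 2‖ȳ‖ there exists a constant P₁ > 0 such that for all N ≥ 1, setting x̃_N = (1/N)∑_{n=1}^{N} x_n and w̃_N = (1/N)∑_{n=1}^{N} w_n, one has |Φ(x̃_N, w̃_N) − Φ(x̄, w̄)| ≤ P₁/N and ‖K x̃_N − w̃_N‖ ≤ 2P₁/(bN). -/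
open Filter Topology

local notation "⟪" x ", " y "⟫_ℝ" => @inner ℝ _ _ x y

lemma grad_ineq {X : Type*} [NormedAddCommGroup X] [InnerProductSpace ℝ X] [CompleteSpace X]
    (h : X → ℝ) (G : X) (a u : X) (hh : ConvexOn ℝ Set.univ h) (hG : HasGradientAt h G a) :
    h a + ⟪G, u - a⟫_ℝ ≤ h u := by
  have hd : HasDerivAt (fun t : ℝ => h (AffineMap.lineMap a u t)) ⟪G, u - a⟫_ℝ 0 := by
    have h1 : HasDerivAt (fun t : ℝ => AffineMap.lineMap a u t) (u - a) (0:ℝ) :=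
      AffineMap.hasDerivAt_lineMap
    have h2 : HasFDerivAt h (InnerProductSpace.toDual ℝ X G) (AffineMap.lineMap a u (0:ℝ)) := by
      simpa using hG.hasFDerivAt
    have := h2.comp_hasDerivAt (0:ℝ) h1
    simp only [InnerProductSpace.toDual_apply_apply] at this
    exact this
  have hc : ConvexOn ℝ Set.univ (fun t : ℝ => h (AffineMap.lineMap a u t)) := by
    exact hh.comp_affineMap (AffineMap.lineMap a u : ℝ →ᵃ[ℝ] X)
  have := hc.le_slope_of_hasDerivAt (Set.mem_univ 0) (Set.mem_univ 1) one_pos hd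
  simp [slope_def_field] at this
  linarith

lemma three {X : Type*} [NormedAddCommGroup X] [InnerProductSpace ℝ X] (a b c : X) :
    2 * ⟪a - b, c - a⟫_ℝ = ‖c - b‖^2 - ‖c - a‖^2 - ‖a - b‖^2 := by
  have : c - b = (c - a) + (a - b) := by abel
  rw [this, norm_add_sq_real, real_inner_comm]; ring

lemma zid {X : Type*} [NormedAddCommGroup X] [InnerProductSpace ℝ X] (x1 z1 z2 u : X) (ψ : ℝ)
    (hψ : 1 < ψ) (hz : z2 = ((ψ - 1) / ψ) • x1 + (1 / ψ) • z1) :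
    ‖u - x1‖^2 = ψ / (ψ-1) * ‖u - z2‖^2 - 1/(ψ-1) * ‖u - z1‖^2 + 1/ψ * ‖x1 - z1‖^2 := by
  have e : u - z2 = ((ψ - 1) / ψ) • (u - x1) + (1 / ψ) • (u - z1) := by
    rw [hz]
    have : u = ((ψ - 1) / ψ + 1/ψ) • u := by
      rw [show (ψ - 1) / ψ + 1/ψ = 1 by field_simp; ring, one_smul]
    nth_rewrite 1 [this]
    module
  have e2 : x1 - z1 = (u - z1) - (u - x1) := by abel
  rw [e, e2, norm_add_sq_real, norm_sub_sq_real (u - z1) (u - x1), norm_smul, norm_smul, real_inner_smul_left,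
    real_inner_smul_right, real_inner_comm (u - x1) (u - z1)]
  have h1 : ψ - 1 ≠ 0 := by linarith
  have h0 : ψ ≠ 0 := by linarith
  simp only [mul_pow, Real.norm_eq_abs, sq_abs]
  field_simp
  ring

lemma step {X Y : Type*}
    [NormedAddCommGroup X] [InnerProductSpace ℝ X] [FiniteDimensional ℝ X]
    [NormedAddCommGroup Y] [InnerProductSpace ℝ Y] [FiniteDimensional ℝ Y]
    (K : X →L[ℝ] Y)
    (f : X → ℝ) (g : Y → ℝ) (h : X → ℝ) (Gp Gn : X)
    (ψ β μ μ' : ℝ) (hψ1 : 1 < ψ) (hψφ : ψ * ψ ≤ ψ + 1)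
    (hβ : 0 < β) (hμ : 0 < μ) (hμ'0 : 0 < μ') 
    (u x0 x1 x2 z1 z2 z3 : X) (v w1 y0 y1 y' : Y) (t0 t1 t2 : ℝ)
    (ht2 : 0 < t2) (ht12 : t2 ≤ t1) (ht01 : t1 ≤ t0)
    (hz2 : z2 = ((ψ - 1) / ψ) • x1 + (1 / ψ) • z1)
    (hz3 : z3 = ((ψ - 1) / ψ) • x2 + (1 / ψ) • z2)
    (hKu : K u = v)
    (hx1 : t0 * (f x1 - f x2) ≤ ⟪x1 - z1 + t0 • (ContinuousLinearMap.adjoint K) y0 + t0 • Gp, x2 - x1⟫_ℝ)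
    (hx2 : t1 * (f x2 - f u) ≤ ⟪x2 - z2 + t1 • (ContinuousLinearMap.adjoint K) y1 + t1 • Gn, u - x2⟫_ℝ)
    (hh : h x1 + ⟪Gn, u - x1⟫_ℝ ≤ h u)
    (hG : t1 * ‖Gn - Gp‖ ≤ μ' * ‖x1 - x0‖)
    (hK : t2 * Real.sqrt β * ‖K (x2 - x1)‖ ≤ μ * ‖x2 - x1‖)
    (hw : g w1 - g v ≤ ⟪y1, w1 - v⟫_ℝ)
    (hy : y1 = y0 + (β * t1) • (K x1 - w1)) 
    (hκ : 0 ≤ ψ * (t1 / t0) - μ^2 * (t1/t2)^2 - 2 * μ') :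
    2 * t1 * (f x1 + h x1 + g w1 - (f u + h u + g v) + ⟪y', K x1 - w1⟫_ℝ) ≤
      (ψ / (ψ-1) * ‖u - z2‖^2 + 1/β * ‖y' - y0‖^2 + μ' * ‖x1 - x0‖^2)
      - (ψ / (ψ-1) * ‖u - z3‖^2 + 1/β * ‖y' - y1‖^2 + μ' * ‖x2 - x1‖^2) := by
  have ht1 : 0 < t1 := by linarith
  have ht0 : 0 < t0 := by linarith
  have hψ0 : 0 < ψ := by linarith
  have hd : t1 / t0 ≤ 1 := by rw [div_le_one ht0]; exact ht01
  have hd0 : 0 ≤ t1 / t0 := by positivity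
  set d := t1 / t0 with hdd
  set r := t1 / t2 with hr
  have hr0 : 0 < r := by positivity
  -- rescaled first inequality
  have ez : x1 - z1 = ψ • (x1 - z2) := by
    rw [hz2, smul_sub, smul_add, smul_smul, smul_smul,
      show ψ * ((ψ - 1) / ψ) = ψ - 1 by field_simp, show ψ * (1 / ψ) = 1 by field_simp]
    module
  have hdt : d * t0 = t1 := by rw [hdd]; field_simp
  have a1 : t1 * (f x1 - f x2) ≤ ψ * d * ⟪x1 - z2, x2 - x1⟫_ℝ + t1 * ⟪y0, K (x2 - x1)⟫_ℝ
      + t1 * ⟪Gp, x2 - x1⟫_ℝ := by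
    have := mul_le_mul_of_nonneg_left hx1 hd0
    rw [ez, inner_add_left, inner_add_left, real_inner_smul_left, real_inner_smul_left,
      real_inner_smul_left, ContinuousLinearMap.adjoint_inner_left, ← mul_assoc, hdt] at this
    refine this.trans (le_of_eq ?_)
    rw [← hdt]; ring
  have a2 : t1 * (f x2 - f u) ≤ ⟪x2 - z2, u - x2⟫_ℝ + t1 * ⟪y1, K (u - x2)⟫_ℝ
      + t1 * ⟪Gn, u - x2⟫_ℝ := by
    rw [inner_add_left, inner_add_left, real_inner_smul_left, real_inner_smul_left,
      ContinuousLinearMap.adjoint_inner_left] at hx2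
    exact hx2
  have b1 := three x2 z2 u
  have b2 := three x1 z2 x2
  have b3 := zid x2 z2 z3 u ψ hψ1 hz3
  have b4 := three y1 y0 y'
  have b5 : ⟪y1 - y0, y' - y1⟫_ℝ = β * t1 * ⟪K x1 - w1, y' - y1⟫_ℝ := by
    rw [← real_inner_smul_left]; congr 1; rw [hy]; abel
  -- inner splitting
  have c1 : ⟪y0, K (x2 - x1)⟫_ℝ + ⟪y1, K (u - x2)⟫_ℝ + ⟪y1, w1 - v⟫_ℝ + ⟪y', K x1 - w1⟫_ℝ
      = ⟪K x1 - w1, y' - y1⟫_ℝ - ⟪y1 - y0, K (x2 - x1)⟫_ℝ := by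
    rw [← real_inner_comm (K x1 - w1) (y' - y1), ← hKu]
    simp only [map_sub, inner_sub_left, inner_sub_right]; ring
  have c2 : ⟪Gp, x2 - x1⟫_ℝ + ⟪Gn, u - x2⟫_ℝ = ⟪Gn, u - x1⟫_ℝ - ⟪Gn - Gp, x2 - x1⟫_ℝ := by
    simp only [inner_sub_left, inner_sub_right]; ring
  -- estimates
  have e1 : -(2 * t1 * ⟪Gn - Gp, x2 - x1⟫_ℝ) ≤ μ' * ‖x1 - x0‖^2 + μ' * ‖x2 - x1‖^2 := by
    have i1 := neg_le_of_abs_le (abs_real_inner_le_norm (Gn - Gp) (x2 - x1))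
    have i2 := mul_le_mul_of_nonneg_right hG (norm_nonneg (x2 - x1))
    have i3 := mul_nonneg hμ'0.le (sq_nonneg (‖x1 - x0‖ - ‖x2 - x1‖))
    have i4 := mul_le_mul_of_nonneg_left i1 ht1.le
    linarith
  have e2 : -(2 * t1 * ⟪y1 - y0, K (x2 - x1)⟫_ℝ) ≤ 1/β * ‖y1 - y0‖^2 + μ^2 * r^2 * ‖x2 - x1‖^2 := by
    have i1 := neg_le_of_abs_le (abs_real_inner_le_norm (y1 - y0) (K (x2 - x1)))
    have hs : 0 < Real.sqrt β := Real.sqrt_pos.2 hβ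
    have i3 : t1 * ‖K (x2 - x1)‖ ≤ μ * r * ‖x2 - x1‖ / Real.sqrt β := by
      rw [le_div_iff₀ hs]
      have : t1 = r * t2 := by rw [hr]; field_simp
      rw [this]
      have := mul_le_mul_of_nonneg_left hK hr0.le
      linarith
    have i2 := mul_le_mul_of_nonneg_left i3 (norm_nonneg (y1 - y0))
    have i4 : 1/β * ‖y1 - y0‖^2 + μ^2 * r^2 * ‖x2 - x1‖^2 - 2 * (‖y1 - y0‖ * (μ * r * ‖x2 - x1‖ / Real.sqrt β))
       = (‖y1 - y0‖ / Real.sqrt β - μ * r * ‖x2 - x1‖)^2 := by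
      rw [sub_sq, div_pow ‖y1 - y0‖, Real.sq_sqrt hβ.le]; ring
    have i5 := sq_nonneg (‖y1 - y0‖ / Real.sqrt β - μ * r * ‖x2 - x1‖)
    rw [← i4] at i5
    have i6 := mul_le_mul_of_nonneg_left i1 ht1.le
    linarith
  have e3 : 0 ≤ (1 + 1/ψ - ψ * d) * ‖x2 - z2‖^2 := by
    apply mul_nonneg _ (sq_nonneg _)
    have : ψ ≤ 1 + 1/ψ := by
      rw [← sub_nonneg, show 1 + 1/ψ - ψ = (ψ + 1 - ψ*ψ)/ψ by field_simp]
      apply div_nonneg _ hψ0.le; linarith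
    have := mul_le_mul_of_nonneg_left hd hψ0.le
    linarith
  have e4 : 0 ≤ ψ * d * ‖x1 - z2‖^2 := by positivity
  have e5 := mul_nonneg hκ (sq_nonneg ‖x2 - x1‖)
  have b6 : 2 * t1 * ⟪K x1 - w1, y' - y1⟫_ℝ = 1/β * (‖y' - y0‖^2 - ‖y' - y1‖^2 - ‖y1 - y0‖^2) := by
    rw [← b4, b5]; field_simp
  have b2' : 2 * (ψ * d * ⟪x1 - z2, x2 - x1⟫_ℝ) = ψ * d * (‖x2 - z2‖^2 - ‖x2 - x1‖^2 - ‖x1 - z2‖^2) := by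
    rw [← b2]; ring
  have b7 : 1/(ψ-1) = ψ/(ψ-1) - 1 := by
    have : ψ - 1 ≠ 0 := by linarith
    field_simp; ring
  rw [b7] at b3
  have hw' := mul_le_mul_of_nonneg_left hw ht1.le
  have hh' := mul_le_mul_of_nonneg_left hh ht1.le
  have c1' := congrArg (fun s => t1 * s) c1
  have c2' := congrArg (fun s => t1 * s) c2
  linarith

lemma sum_bound (G A B t : ℕ → ℝ) (m M : ℝ) (n0 : ℕ) (hm : 0 < m) (ht : ∀ k, m ≤ t k)
    (hanti : ∀ k, t (k+1) ≤ t k) (hG : ∀ k, n0 ≤ k → 2 * t k * G k ≤ A k - A (k+1))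
    (hA0 : ∀ k, 0 ≤ A k) (hAM : ∀ k, n0 ≤ k → A k ≤ M) (hGB : ∀ k, G k ≤ B k)
    (hB : ∀ k, 0 ≤ B k) (N : ℕ) :
    ∑ k ∈ Finset.range N, G k ≤ ∑ k ∈ Finset.range n0, B k + M / (2 * m) := by
  have hpos : ∀ k, 0 < t k := fun k => hm.trans_le (ht k)
  have hM : 0 ≤ M := (hA0 n0).trans (hAM n0 le_rfl)
  rcases le_total N n0 with hN | hN
  · have h1 : ∑ k ∈ Finset.range N, G k ≤ ∑ k ∈ Finset.range N, B k :=
      Finset.sum_le_sum fun k _ => hGB k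
    have h2 : ∑ k ∈ Finset.range N, B k ≤ ∑ k ∈ Finset.range n0, B k :=
      Finset.sum_le_sum_of_subset_of_nonneg (Finset.range_mono hN) fun k _ _ => hB k
    have h3 : 0 ≤ M / (2 * m) := by positivity
    linarith
  · have key : ∑ k ∈ Finset.range N, G k ≤
        ∑ k ∈ Finset.range n0, B k + (M - A N) / (2 * t N) := by
      induction N, hN using Nat.le_induction with
      | base =>
        have h1 : ∑ k ∈ Finset.range n0, G k ≤ ∑ k ∈ Finset.range n0, B k :=
          Finset.sum_le_sum fun k _ => hGB k
        have h2 : 0 ≤ (M - A n0) / (2 * t n0) :=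
          div_nonneg (by linarith [hAM n0 le_rfl]) (by linarith [hpos n0])
        linarith
      | succ N hN ih =>
        rw [Finset.sum_range_succ]
        have h1 : G N ≤ (A N - A (N+1)) / (2 * t N) := by
          rw [le_div_iff₀ (by linarith [hpos N])]
          linarith [hG N hN]
        have h2 : (M - A N) / (2 * t N) + (A N - A (N+1)) / (2 * t N)
            = (M - A (N+1)) / (2 * t N) := by rw [← add_div]; ring
        have h3 : (M - A (N+1)) / (2 * t N) ≤ (M - A (N+1)) / (2 * t (N+1)) :=
          div_le_div_of_nonneg_left (by linarith [hAM (N+1) (by omega)])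
            (by linarith [hpos (N+1)]) (by linarith [hanti N])
        linarith
    have h4 : (M - A N) / (2 * t N) ≤ M / (2 * m) :=
      div_le_div₀ hM (by linarith [hA0 N]) (by linarith) (by linarith [ht N])
    linarith

lemma sum_Icc_shift {E : Type*} [AddCommMonoid E] (a : ℕ → E) (N : ℕ) :
    ∑ n ∈ Finset.Icc 1 N, a n = ∑ k ∈ Finset.range N, a (k+1) := by
  induction N with
  | zero => simp
  | succ N ih => rw [Finset.sum_Icc_succ_top (by omega), ih, Finset.sum_range_succ]

lemma jensen {E : Type*} [AddCommGroup E] [Module ℝ E] (f : E → ℝ)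
    (hf : ConvexOn ℝ Set.univ f) (a : ℕ → E) (N : ℕ) (hN : 1 ≤ N) :
    N * f ((1 / (N : ℝ)) • ∑ k ∈ Finset.range N, a k) ≤ ∑ k ∈ Finset.range N, f (a k) := by
  have hN' : (0:ℝ) < N := by exact_mod_cast hN
  have := hf.map_sum_le (t := Finset.range N) (w := fun _ => 1 / (N:ℝ)) (p := a)
    (fun _ _ => by positivity) (by simp; field_simp) (fun _ _ => Set.mem_univ _)
  rw [← Finset.smul_sum, ← Finset.smul_sum, smul_eq_mul] at this
  calc _ ≤ N * (1 / (N:ℝ) * ∑ k ∈ Finset.range N, f (a k)) :=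
        mul_le_mul_of_nonneg_left this hN'.le
    _ = _ := by field_simp

theorem pgrpda_ergodic_sublinear_rate {X Y : Type*}
    [NormedAddCommGroup X] [InnerProductSpace ℝ X] [FiniteDimensional ℝ X]
    [NormedAddCommGroup Y] [InnerProductSpace ℝ Y] [FiniteDimensional ℝ Y]
    (K : X →L[ℝ] Y) (hK : K ≠ 0)
    (f : X → ℝ) (g : Y → ℝ) (h : X → ℝ) (Gh : X → X)
    (hf : ConvexOn ℝ Set.univ f) (hg : ConvexOn ℝ Set.univ g)
    (hh : ConvexOn ℝ Set.univ h)
    (hGh : ∀ a : X, HasGradientAt h (Gh a) a)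
    (L : ℝ) (hL : 0 < L) (hLip : ∀ a b : X, ‖Gh a - Gh b‖ ≤ L * ‖a - b‖)
    (ψ β μ μ' : ℝ) (hψ1 : 1 < ψ) (hψφ : ψ ≤ (1 + Real.sqrt 5) / 2)
    (hβ : 0 < β) (hμ'0 : 0 < μ') (hμμ' : 2 * μ' < μ) (hμψ : μ < ψ / 2)
    (xb : X) (wb yb : Y)
    (hsaddle : ∀ (x' : X) (w' y' : Y),
      f xb + h xb + g wb + ⟪y', K xb - wb⟫_ℝ ≤
          f xb + h xb + g wb + ⟪yb, K xb - wb⟫_ℝ ∧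
        f xb + h xb + g wb + ⟪yb, K xb - wb⟫_ℝ ≤
          f x' + h x' + g w' + ⟪yb, K x' - w'⟫_ℝ)
    (x z : ℕ → X) (w y : ℕ → Y) (τ : ℕ → ℝ)
    (hτ0 : 0 < τ 0) (hz0 : z 0 = x 0)
    (hz : ∀ n, 1 ≤ n → z n = ((ψ - 1) / ψ) • x (n - 1) + (1 / ψ) • z (n - 1))
    (hx : ∀ n, 1 ≤ n → ∀ u : X,
      τ (n - 1) * (f (x n) - f u) ≤
        ⟪x n - z n + τ (n - 1) • (ContinuousLinearMap.adjoint K) (y (n - 1))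
            + τ (n - 1) • Gh (x (n - 1)), u - x n⟫_ℝ)
    (hτ : ∀ n, 1 ≤ n → τ n = min (τ (n - 1)) (min
        (if ‖K (x n - x (n - 1))‖ = 0 then τ (n - 1)
          else μ * ‖x n - x (n - 1)‖ / (Real.sqrt β * ‖K (x n - x (n - 1))‖))
        (if ‖Gh (x n) - Gh (x (n - 1))‖ = 0 then τ (n - 1)
          else μ' * ‖x n - x (n - 1)‖ / ‖Gh (x n) - Gh (x (n - 1))‖)))
    (hw : ∀ n, 1 ≤ n → ∀ v : Y,
      g (w n) - g v ≤ ⟪y (n - 1) + (β * τ n) • (K (x n) - w n), w n - v⟫_ℝ)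
    (hy : ∀ n, 1 ≤ n → y n = y (n - 1) + (β * τ n) • (K (x n) - w n)) :
    ∀ b : ℝ, 0 < b → 2 * ‖yb‖ ≤ b →
      ∃ P₁ : ℝ, 0 < P₁ ∧ ∀ N : ℕ, 1 ≤ N →
        |(f ((1 / (N : ℝ)) • ∑ n ∈ Finset.Icc 1 N, x n) + h ((1 / (N : ℝ)) • ∑ n ∈ Finset.Icc 1 N, x n) + g ((1 / (N : ℝ)) • ∑ n ∈ Finset.Icc 1 N, w n))
            - (f xb + h xb + g wb)| ≤ P₁ / N ∧
        ‖K ((1 / (N : ℝ)) • ∑ n ∈ Finset.Icc 1 N, x n) - ((1 / (N : ℝ)) • ∑ n ∈ Finset.Icc 1 N, w n)‖ ≤ 2 * P₁ / (b * N) := by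
  intro b hb hyb
  have hμ : 0 < μ := by linarith
  have hψψ : ψ * ψ ≤ ψ + 1 := by
    have h5 : Real.sqrt 5 ^ 2 = 5 := Real.sq_sqrt (by norm_num)
    nlinarith [Real.sqrt_nonneg 5]
  have hμ1 : μ < 1 := by nlinarith
  have hs : 0 < Real.sqrt β := Real.sqrt_pos.2 hβ
  -- feasibility
  have hKx : K xb = wb := by
    have := (hsaddle xb wb (yb + (K xb - wb))).1
    rw [inner_add_left, real_inner_self_eq_norm_sq] at this
    have h0 : ‖K xb - wb‖ = 0 := by
      have := sq_nonneg ‖K xb - wb‖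
      exact pow_eq_zero_iff (two_ne_zero) |>.1 (by linarith)
    exact sub_eq_zero.1 (norm_eq_zero.1 h0)
  have hsad : ∀ x' w', f xb + h xb + g wb ≤ f x' + h x' + g w' + ⟪yb, K x' - w'⟫_ℝ := by
    intro x' w'
    have := (hsaddle x' w' yb).2
    rw [hKx, sub_self, inner_zero_right, add_zero] at this
    exact this
  -- step sizes
  have hτ' : ∀ n, τ (n+1) = min (τ n) (min
        (if ‖K (x (n+1) - x n)‖ = 0 then τ n
          else μ * ‖x (n+1) - x n‖ / (Real.sqrt β * ‖K (x (n+1) - x n)‖))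
        (if ‖Gh (x (n+1)) - Gh (x n)‖ = 0 then τ n
          else μ' * ‖x (n+1) - x n‖ / ‖Gh (x (n+1)) - Gh (x n)‖)) :=
    fun n => hτ (n+1) (by omega)
  have hKn : 0 < ‖K‖ := norm_pos_iff.2 hK
  obtain ⟨m, hm, hmτ⟩ : ∃ m : ℝ, 0 < m ∧ ∀ n, m ≤ τ n := by
    refine ⟨min (τ 0) (min (μ / (Real.sqrt β * ‖K‖)) (μ' / L)), by positivity, ?_⟩
    intro n
    induction n with
    | zero => exact min_le_left _ _
    | succ n ih =>
      rw [hτ']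
      refine le_min ih (le_min ?_ ?_)
      · split_ifs with h0
        · exact ih
        · refine ((min_le_right _ _).trans (min_le_left _ _)).trans ?_
          have h1 : 0 < ‖K (x (n+1) - x n)‖ := lt_of_le_of_ne (norm_nonneg _) (Ne.symm h0)
          rw [div_le_div_iff₀ (by positivity) (by positivity)]
          have := mul_le_mul_of_nonneg_left (K.le_opNorm (x (n+1) - x n))
            (mul_nonneg hμ.le hs.le)
          linarith
      · split_ifs with h0
        · exact ih
        · refine ((min_le_right _ _).trans (min_le_right _ _)).trans ?_
          have h1 : 0 < ‖Gh (x (n+1)) - Gh (x n)‖ := lt_of_le_of_ne (norm_nonneg _) (Ne.symm h0)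
          rw [div_le_div_iff₀ hL h1]
          have := mul_le_mul_of_nonneg_left (hLip (x (n+1)) (x n)) hμ'0.le
          linarith
  have hτpos : ∀ n, 0 < τ n := fun n => hm.trans_le (hmτ n)
  have hanti : ∀ n, τ (n+1) ≤ τ n := fun n => by rw [hτ']; exact min_le_left _ _
  have hτK : ∀ n, τ (n+1) * Real.sqrt β * ‖K (x (n+1) - x n)‖ ≤ μ * ‖x (n+1) - x n‖ := by
    intro n
    by_cases h0 : ‖K (x (n+1) - x n)‖ = 0
    · rw [h0, mul_zero]; positivity
    · have h1 : 0 < ‖K (x (n+1) - x n)‖ := lt_of_le_of_ne (norm_nonneg _) (Ne.symm h0)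
      have h2 : τ (n+1) ≤ μ * ‖x (n+1) - x n‖ / (Real.sqrt β * ‖K (x (n+1) - x n)‖) := by
        have h3 := hτ' n
        rw [if_neg h0] at h3
        rw [h3]
        exact (min_le_right _ _).trans (min_le_left _ _)
      rw [le_div_iff₀ (by positivity)] at h2
      linarith
  have hτG : ∀ n, τ (n+1) * ‖Gh (x (n+1)) - Gh (x n)‖ ≤ μ' * ‖x (n+1) - x n‖ := by
    intro n
    by_cases h0 : ‖Gh (x (n+1)) - Gh (x n)‖ = 0
    · rw [h0, mul_zero]; positivity
    · have h1 : 0 < ‖Gh (x (n+1)) - Gh (x n)‖ := lt_of_le_of_ne (norm_nonneg _) (Ne.symm h0)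
      have h2 : τ (n+1) ≤ μ' * ‖x (n+1) - x n‖ / ‖Gh (x (n+1)) - Gh (x n)‖ := by
        have h3 := hτ' n
        rw [if_neg h0] at h3
        rw [h3]
        exact (min_le_right _ _).trans (min_le_right _ _)
      rwa [le_div_iff₀ h1] at h2
  -- eventually good coefficient
  obtain ⟨n0, hn0⟩ : ∃ n0, ∀ k, n0 ≤ k →
      0 ≤ ψ * (τ (k+1) / τ k) - μ^2 * (τ (k+1) / τ (k+2))^2 - 2 * μ' := by
    have hlim := tendsto_atTop_ciInf (antitone_nat_of_succ_le hanti)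
      ⟨m, by rintro _ ⟨n, rfl⟩; exact hmτ n⟩
    set l := ⨅ i, τ i
    have hl : m ≤ l := ge_of_tendsto' hlim hmτ
    have hl0 : l ≠ 0 := by linarith
    have l1 := hlim.comp (tendsto_add_atTop_nat 1)
    have l2 := hlim.comp (tendsto_add_atTop_nat 2)
    have lim := (((l1.div hlim hl0).const_mul ψ).sub
      (((l1.div l2 hl0).pow 2).const_mul (μ^2))).sub_const (2 * μ')
    rw [div_self hl0] at lim
    have hpos : 0 < ψ * 1 - μ^2 * 1^2 - 2 * μ' := by nlinarith
    obtain ⟨n0, hn0⟩ := eventually_atTop.1 (lim.eventually (lt_mem_nhds hpos))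
    exact ⟨n0, fun k hk => (hn0 k hk).le⟩
  set A : Y → ℕ → ℝ := fun y' k => ψ / (ψ-1) * ‖xb - z (k+2)‖^2 + 1/β * ‖y' - y k‖^2
    + μ' * ‖x (k+1) - x k‖^2 with hA
  set G : Y → ℕ → ℝ := fun y' k => f (x (k+1)) + h (x (k+1)) + g (w (k+1))
    - (f xb + h xb + g wb) + ⟪y', K (x (k+1)) - w (k+1)⟫_ℝ with hG
  have hstep : ∀ y' k, n0 ≤ k → 2 * τ (k+1) * G y' k ≤ A y' k - A y' (k+1) := by
    intro y' k hk
    have hyk : y (k+1) = y k + (β * τ (k+1)) • (K (x (k+1)) - w (k+1)) := hy (k+1) (by omega)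
    have hwk := hw (k+1) (by omega) wb
    rw [Nat.add_sub_cancel, ← hyk] at hwk
    exact step K f g h (Gh (x k)) (Gh (x (k+1))) ψ β μ μ' hψ1 hψψ hβ hμ hμ'0 xb (x k) (x (k+1))
      (x (k+2)) (z (k+1)) (z (k+2)) (z (k+3)) wb (w (k+1)) (y k) (y (k+1)) y' (τ k) (τ (k+1))
      (τ (k+2)) (hτpos _) (hanti _) (hanti _) (hz (k+2) (by omega)) (hz (k+3) (by omega)) hKx
      (hx (k+1) (by omega) _) (hx (k+2) (by omega) _) (grad_ineq h _ _ _ hh (hGh _))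
      (hτG k) (hτK (k+1)) hwk hyk (hn0 k hk)
  have hc : 0 < ψ / (ψ - 1) := div_pos (by linarith) (by linarith)
  have hA0 : ∀ y' k, 0 ≤ A y' k := by
    intro y' k
    simp only [hA]
    positivity
  have hAb : ∀ k, n0 ≤ k → A yb k ≤ A yb n0 := by
    intro k hk
    induction k, hk using Nat.le_induction with
    | base => exact le_rfl
    | succ k hk ih =>
      have h1 := hstep yb k hk
      have h2 : 0 ≤ G yb k := by
        have := hsad (x (k+1)) (w (k+1))
        simp only [hG]; linarith
      have h3 := mul_nonneg (mul_nonneg zero_le_two (hτpos (k+1)).le) h2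
      linarith
  set M : ℝ := 2 * A yb n0 + 2 / β * (b + ‖yb‖)^2 with hM
  have hAM : ∀ y', ‖y'‖ ≤ b → ∀ k, n0 ≤ k → A y' k ≤ M := by
    intro y' hy' k hk
    have h1 := hAb k hk
    have h2 : ‖y' - y k‖ ≤ (b + ‖yb‖) + ‖yb - y k‖ := by
      have h3 := norm_sub_le_norm_sub_add_norm_sub y' yb (y k)
      have h4 := norm_sub_le y' yb
      linarith
    have h3 : ‖y' - y k‖^2 ≤ 2 * (b + ‖yb‖)^2 + 2 * ‖yb - y k‖^2 := by
      have := pow_le_pow_left₀ (norm_nonneg _) h2 2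
      nlinarith [sq_nonneg ((b + ‖yb‖) - ‖yb - y k‖)]
    have h4 := mul_le_mul_of_nonneg_left h3 (by positivity : 0 ≤ 1/β)
    have h5 : 1/β * (2 * (b + ‖yb‖)^2 + 2 * ‖yb - y k‖^2)
      = 2/β * (b + ‖yb‖)^2 + 2 * (1/β * ‖yb - y k‖^2) := by ring
    have h6 : 0 ≤ ψ / (ψ-1) * ‖xb - z (k+2)‖^2 := by positivity
    have h7 : 0 ≤ μ' * ‖x (k+1) - x k‖^2 := by positivity
    simp only [hM]
    have h8 : A y' k ≤ 2 * A yb k + 2/β * (b + ‖yb‖)^2 := by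
      simp only [hA]; linarith
    linarith
  set B : ℕ → ℝ := fun k => |f (x (k+1)) + h (x (k+1)) + g (w (k+1))
    - (f xb + h xb + g wb)| + b * ‖K (x (k+1)) - w (k+1)‖ with hB
  have hB0 : ∀ k, 0 ≤ B k := fun k => by simp only [hB]; positivity
  have hGB : ∀ y', ‖y'‖ ≤ b → ∀ k, G y' k ≤ B k := by
    intro y' hy' k
    have h1 := real_inner_le_norm y' (K (x (k+1)) - w (k+1))
    have h2 := mul_le_mul_of_nonneg_right hy' (norm_nonneg (K (x (k+1)) - w (k+1)))
    have h3 := le_abs_self (f (x (k+1)) + h (x (k+1)) + g (w (k+1)) - (f xb + h xb + g wb))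
    simp only [hG, hB]; linarith
  set P : ℝ := ∑ k ∈ Finset.range n0, B k + M / (2 * m) with hP
  have hsum : ∀ y', ‖y'‖ ≤ b → ∀ N, ∑ k ∈ Finset.range N, G y' k ≤ P := fun y' hy' N =>
    sum_bound (G y') (A y') B (fun k => τ (k+1)) m M n0 hm (fun k => hmτ _) (fun k => hanti _)
      (hstep y') (hA0 y') (hAM y' hy') (hGB y' hy') hB0 N
  have hP0 : 0 ≤ P := by simpa using hsum 0 (by simpa using hb.le) 0
  refine ⟨P + 1, by linarith, fun N hN => ?_⟩
  have hN0 : (0:ℝ) < N := by exact_mod_cast hN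
  rw [sum_Icc_shift x, sum_Icc_shift w]
  set xt := (1 / (N : ℝ)) • ∑ k ∈ Finset.range N, x (k+1) with hxt
  set wt := (1 / (N : ℝ)) • ∑ k ∈ Finset.range N, w (k+1) with hwt
  have jf := jensen f hf (fun k => x (k+1)) N hN
  have jh := jensen h hh (fun k => x (k+1)) N hN
  have jg := jensen g hg (fun k => w (k+1)) N hN
  simp only [← hxt, ← hwt] at jf jh jg
  have hres : ∑ k ∈ Finset.range N, (K (x (k+1)) - w (k+1)) = (N:ℝ) • (K xt - wt) := by
    rw [hxt, hwt, map_smul, map_sum, ← smul_sub, smul_smul, Finset.sum_sub_distrib,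
      mul_one_div_cancel hN0.ne', one_smul]
  have main : ∀ y', ‖y'‖ ≤ b →
      N * (f xt + h xt + g wt - (f xb + h xb + g wb) + ⟪y', K xt - wt⟫_ℝ) ≤ P := by
    intro y' hy'
    have h1 := hsum y' hy' N
    simp only [hG] at h1
    rw [Finset.sum_add_distrib, Finset.sum_sub_distrib, Finset.sum_add_distrib,
      Finset.sum_add_distrib, ← inner_sum, hres, real_inner_smul_right, Finset.sum_const,
      Finset.card_range, nsmul_eq_mul] at h1
    linarith
  have hR := norm_nonneg (K xt - wt)
  have main2 : N * (f xt + h xt + g wt - (f xb + h xb + g wb) + b * ‖K xt - wt‖) ≤ P := by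
    by_cases h0 : ‖K xt - wt‖ = 0
    · have := main 0 (by simpa using hb.le)
      rw [inner_zero_left] at this
      rw [h0, mul_zero]; exact this
    · have := main ((b / ‖K xt - wt‖) • (K xt - wt)) (by
        rw [norm_smul, norm_div, norm_norm, div_mul_cancel₀ _ h0, Real.norm_of_nonneg hb.le])
      rw [real_inner_smul_left, real_inner_self_eq_norm_sq] at this
      have e : b / ‖K xt - wt‖ * ‖K xt - wt‖^2 = b * ‖K xt - wt‖ := by field_simp
      rwa [e] at this
  have low : -(b / 2 * ‖K xt - wt‖) ≤ f xt + h xt + g wt - (f xb + h xb + g wb) := by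
    have h1 := hsad xt wt
    have h2 := real_inner_le_norm yb (K xt - wt)
    have h3 := mul_le_mul_of_nonneg_right hyb hR
    linarith
  have m3 : f xt + h xt + g wt - (f xb + h xb + g wb) + b * ‖K xt - wt‖ ≤ (P + 1) / N := by
    rw [le_div_iff₀ hN0]; linarith
  have hbR := mul_nonneg hb.le hR
  refine ⟨abs_le.2 ⟨by linarith, by linarith⟩, ?_⟩
  have e : 2 * (P + 1) / (b * N) = 2 / b * ((P + 1) / N) := by field_simp
  rw [e]
  have h1 : b / 2 * ‖K xt - wt‖ ≤ (P + 1) / N := by linarith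
  calc ‖K xt - wt‖ = 2 / b * (b / 2 * ‖K xt - wt‖) := by field_simp
    _ ≤ _ := mul_le_mul_of_nonneg_left h1 (by positivity)
end

section
/- Suppose in addition that h is γ_h-strongly convex, g* is γ_{g*}-strongly convex, and the sequence (x_n, y_n) generated by P-GRPDA in primal-dual form converges to the unique primal-dual solution (x̄, ȳ). Then there exist constants Z, V₁, V₂ > 0, a scalar ζ ∈ (0,1), and a natural number n₄ such that for all n ≥ n₄: ‖x̄ − z_{n+2}‖² ≤ Z·ζⁿ, ‖ȳ − y_n‖² ≤ V₁·ζⁿ, ‖x_n − x_{n+1}‖² ≤ V₂·ζⁿ, and moreover ‖x_n − x̄‖ ≤ √V₂·ζ^{n/2}/(1 − ζ^{1/2}); in particular (x_n, y_n) converges R-linearly to (x̄, ȳ). -/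
open Filter Topology

local notation "⟪" x ", " y "⟫_ℝ" => @inner ℝ _ _ x y

def IsSubgradient {E : Type*} [NormedAddCommGroup E] [InnerProductSpace ℝ E]
    (q : E → ℝ) (u : E) (p : E) : Prop :=
  ∀ v : E, q p + ⟪u, v - p⟫_ℝ ≤ q v


lemma pg_norms {X : Type*} [NormedAddCommGroup X] [InnerProductSpace ℝ X] (a b c : X) :
    2 * ⟪a - b, c - a⟫_ℝ = ‖c - b‖ ^ 2 - ‖a - b‖ ^ 2 - ‖a - c‖ ^ 2 := by
  have h1 : c - b = (a - b) + (c - a) := by abel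
  rw [h1, norm_add_sq_real, norm_sub_rev a c]; ring

lemma pg_zid {X : Type*} [NormedAddCommGroup X] [InnerProductSpace ℝ X] (ψ : ℝ) (hψ : 1 < ψ)
    (x2 z2 z3 xb : X) (hz : z3 = ((ψ - 1) / ψ) • x2 + (1 / ψ) • z2) :
    ‖x2 - xb‖ ^ 2 = ψ / (ψ - 1) * ‖xb - z3‖ ^ 2 - 1 / (ψ - 1) * ‖xb - z2‖ ^ 2
      + 1 / ψ * ‖x2 - z2‖ ^ 2 := by
  have h1 : xb - z3 = -(((ψ - 1) / ψ) • (x2 - xb) + (1 / ψ) • (z2 - xb)) := by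
    have : (ψ - 1) / ψ + 1 / ψ = 1 := by field_simp; ring
    have h2 : xb = ((ψ - 1) / ψ) • xb + (1 / ψ) • xb := by rw [← add_smul, this, one_smul]
    rw [hz, smul_sub, smul_sub]
    nth_rewrite 1 [h2]
    abel
  have h3 : x2 - z2 = (x2 - xb) - (z2 - xb) := by abel
  rw [h1, h3, norm_neg, norm_add_sq_real, norm_sub_sq_real (x2 - xb) (z2 - xb), norm_smul, norm_smul, inner_smul_left,
    inner_smul_right, norm_sub_rev xb z2, mul_pow, mul_pow, Real.norm_eq_abs, Real.norm_eq_abs,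
    sq_abs, sq_abs]
  have : ψ - 1 ≠ 0 := by linarith
  have : ψ ≠ 0 := by linarith
  simp only [conj_trivial]
  field_simp
  ring

lemma pg_basic {X Y : Type*}
    [NormedAddCommGroup X] [InnerProductSpace ℝ X] [FiniteDimensional ℝ X]
    [NormedAddCommGroup Y] [InnerProductSpace ℝ Y] [FiniteDimensional ℝ Y]
    (K : X →L[ℝ] Y) (f : X → ℝ) (g : Y → ℝ) (x0 x1 x2 z1 z2 xb G0 G1 Gb : X) (y0 y1 yb : Y)
    (τ0 τ1 β ψ γh γg : ℝ) (h0 : 0 < τ0) (h1 : 0 < τ1) (hβ : 0 < β)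
    (hz : x1 - z1 = ψ • (x1 - z2))
    (hA : τ1 * (f x2 - f xb) ≤ ⟪x2 - z2 + τ1 • (ContinuousLinearMap.adjoint K) y1 + τ1 • G1,
      xb - x2⟫_ℝ)
    (hB : τ0 * (f x1 - f x2) ≤ ⟪x1 - z1 + τ0 • (ContinuousLinearMap.adjoint K) y0 + τ0 • G0,
      x2 - x1⟫_ℝ)
    (hC : β * τ1 * (g y1 - g yb) ≤ ⟪y1 - y0 - (β * τ1) • K x1, yb - y1⟫_ℝ
          - β * τ1 * γg / 2 * ‖yb - y1‖ ^ 2)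
    (hF : f xb + ⟪-(ContinuousLinearMap.adjoint K) yb - Gb, x1 - xb⟫_ℝ ≤ f x1)
    (hG : ⟪K xb, y1 - yb⟫_ℝ + γg / 2 * ‖y1 - yb‖ ^ 2 ≤ g y1 - g yb)
    (hH : γh * ‖x1 - xb‖ ^ 2 ≤ ⟪G1 - Gb, x1 - xb⟫_ℝ) :
    0 ≤ ⟪x2 - z2, xb - x2⟫_ℝ + ψ * (τ1 / τ0) * ⟪x1 - z2, x2 - x1⟫_ℝ
      + 1 / β * ⟪y1 - y0, yb - y1⟫_ℝ + τ1 * ⟪y0 - y1, K (x2 - x1)⟫_ℝ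
      + τ1 * ⟪G1 - G0, x1 - x2⟫_ℝ - τ1 * γh * ‖x1 - xb‖ ^ 2 - τ1 * γg * ‖y1 - yb‖ ^ 2 := by
  have hB' := mul_le_mul_of_nonneg_left hB (div_pos h1 h0).le
  have hC' := mul_le_mul_of_nonneg_left hC (one_div_pos.2 hβ).le
  have hF' := mul_le_mul_of_nonneg_left hF h1.le
  have hG' := mul_le_mul_of_nonneg_left hG h1.le
  have hH' := mul_le_mul_of_nonneg_left hH h1.le
  rw [norm_sub_rev yb y1] at hC'
  rw [hz] at hB'
  have e1 : τ1 / τ0 * (τ0 * (f x1 - f x2)) = τ1 * (f x1 - f x2) := by field_simp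
  have e2 : 1 / β * (β * τ1 * (g y1 - g yb)) = τ1 * (g y1 - g yb) := by field_simp
  rw [e1] at hB'
  rw [e2] at hC'
  have eB : τ1 / τ0 * ⟪ψ • (x1 - z2) + τ0 • (ContinuousLinearMap.adjoint K) y0 + τ0 • G0,
      x2 - x1⟫_ℝ = ψ * (τ1 / τ0) * ⟪x1 - z2, x2 - x1⟫_ℝ + τ1 * ⟪y0, K (x2 - x1)⟫_ℝ
        + τ1 * ⟪G0, x2 - x1⟫_ℝ := by
    rw [inner_add_left, inner_add_left, inner_smul_left, inner_smul_left, inner_smul_left,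
      ContinuousLinearMap.adjoint_inner_left]
    simp only [conj_trivial]
    field_simp
  have eC : 1 / β * (⟪y1 - y0 - (β * τ1) • K x1, yb - y1⟫_ℝ
          - β * τ1 * γg / 2 * ‖y1 - yb‖ ^ 2) = 1 / β * ⟪y1 - y0, yb - y1⟫_ℝ
          - τ1 * ⟪K x1, yb - y1⟫_ℝ - τ1 * γg / 2 * ‖y1 - yb‖ ^ 2 := by
    rw [inner_sub_left, inner_smul_left]
    simp only [conj_trivial]
    field_simp
  rw [eB] at hB'
  rw [eC] at hC'
  rw [inner_add_left, inner_add_left, inner_smul_left, inner_smul_left,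
      ContinuousLinearMap.adjoint_inner_left] at hA
  simp only [conj_trivial] at hA
  rw [inner_sub_left, inner_neg_left, ContinuousLinearMap.adjoint_inner_left] at hF'
  simp only [map_sub, inner_sub_left (𝕜 := ℝ) y0 y1, inner_sub_left (𝕜 := ℝ) G1, inner_sub_right (𝕜 := ℝ) G1,
    inner_sub_right (𝕜 := ℝ) G0, inner_sub_right (𝕜 := ℝ) Gb, inner_sub_right (𝕜 := ℝ) y1, inner_sub_right (𝕜 := ℝ) y0,
    inner_sub_right (𝕜 := ℝ) yb, inner_sub_right (𝕜 := ℝ) (K _)] at *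
  rw [real_inner_comm y1 (K xb), real_inner_comm yb (K xb)] at hG'
  rw [real_inner_comm y1 (K x1), real_inner_comm yb (K x1)] at hC'
  nlinarith [hA, hB', hC', hF', hG', hH']

set_option maxHeartbeats 1000000 in
lemma pg_step_s10 {X Y : Type*}
    [NormedAddCommGroup X] [InnerProductSpace ℝ X]
    [NormedAddCommGroup Y] [InnerProductSpace ℝ Y]
    (K : X →L[ℝ] Y) (x0 x1 x2 z2 z3 xb G0 G1 : X) (y0 y1 yb : Y)
    (τ1 τm θ r β ψ μ μ' c ε γh γg : ℝ) (hβ : 0 < β) (hψ1 : 1 < ψ)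
    (hψφ : ψ ^ 2 ≤ ψ + 1) (hτm : 0 < τm) (hτ : τm ≤ τ1)
    (hμ' : 0 < μ') (hθ : θ ≤ 1) (hγh : 0 < γh) (hγg : 0 < γg)
    (hz : z3 = ((ψ - 1) / ψ) • x2 + (1 / ψ) • z2)
    (hKr : τ1 * (Real.sqrt β * ‖K (x2 - x1)‖) ≤ r * ‖x2 - x1‖)
    (hGr : τ1 * ‖G1 - G0‖ ≤ μ' * ‖x1 - x0‖)
    (hr0 : 0 ≤ r) (hr1 : r ≤ 1) (hψθ : 1 ≤ ψ * θ) (hc : c + μ' + r ≤ ψ * θ)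
    (hε1 : 2 * ε ≤ 2 * τm * γh) (hε2 : 2 * ε ≤ 1) (hε0 : 0 ≤ ε)
    (hb : 0 ≤ ⟪x2 - z2, xb - x2⟫_ℝ + ψ * θ * ⟪x1 - z2, x2 - x1⟫_ℝ
      + 1 / β * ⟪y1 - y0, yb - y1⟫_ℝ + τ1 * ⟪y0 - y1, K (x2 - x1)⟫_ℝ
      + τ1 * ⟪G1 - G0, x1 - x2⟫_ℝ - τ1 * γh * ‖x1 - xb‖ ^ 2 - τ1 * γg * ‖y1 - yb‖ ^ 2) :
    ψ / (ψ - 1) * ‖xb - z3‖ ^ 2 + (1 / β + 2 * τm * γg) * ‖yb - y1‖ ^ 2 + c * ‖x1 - x2‖ ^ 2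
      ≤ (ψ / (ψ - 1) - ε) * ‖xb - z2‖ ^ 2 + 1 / β * ‖yb - y0‖ ^ 2 + μ' * ‖x0 - x1‖ ^ 2 := by
  have n1 := pg_norms x2 z2 xb
  have n2 := pg_norms x1 z2 x2
  have n3 := pg_norms y1 y0 yb
  have n4 := pg_zid ψ hψ1 x2 z2 z3 xb hz
  have hψ0 : 0 < ψ := by linarith
  -- Young for K
  have k1 : 2 * (τ1 * ⟪y0 - y1, K (x2 - x1)⟫_ℝ) ≤ 1 / β * ‖y1 - y0‖ ^ 2 + r * ‖x1 - x2‖ ^ 2 := by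
    have c1 : ⟪y0 - y1, K (x2 - x1)⟫_ℝ ≤ ‖y1 - y0‖ * ‖K (x2 - x1)‖ := by
      rw [norm_sub_rev y1 y0]; exact real_inner_le_norm _ _
    have hs : 0 < Real.sqrt β := Real.sqrt_pos.2 hβ
    obtain ⟨t, ht⟩ : ∃ t, t = ‖y1 - y0‖ / Real.sqrt β := ⟨_, rfl⟩
    have ht2 : 1 / β * ‖y1 - y0‖ ^ 2 = t ^ 2 := by
      rw [ht, div_pow, Real.sq_sqrt hβ.le]; ring
    have ht1 : ‖y1 - y0‖ = t * Real.sqrt β := by rw [ht]; field_simp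
    have ht0 : 0 ≤ t := by rw [ht]; positivity
    rw [ht2, norm_sub_rev x1 x2]
    have c2 := mul_le_mul_of_nonneg_left c1 (hτm.le.trans hτ)
    rw [ht1] at c2
    have c3 := mul_le_mul_of_nonneg_left hKr ht0
    have c4 : τ1 * ⟪y0 - y1, K (x2 - x1)⟫_ℝ ≤ t * (r * ‖x2 - x1‖) := by
      refine c2.trans (le_trans (le_of_eq ?_) c3)
      ring
    have c5 := mul_nonneg hr0 (sq_nonneg (t - ‖x2 - x1‖))
    have c6 := mul_nonneg (sub_nonneg.2 hr1) (sq_nonneg t)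
    generalize ⟪y0 - y1, K (x2 - x1)⟫_ℝ = q at *
    generalize ‖x2 - x1‖ = b at *
    clear c1 c2 c3 hb n1 n2 n3 n4 hKr ht2 ht1 ht hGr
    linarith
  have k2 : 2 * (τ1 * ⟪G1 - G0, x1 - x2⟫_ℝ) ≤ μ' * ‖x0 - x1‖ ^ 2 + μ' * ‖x1 - x2‖ ^ 2 := by
    have c1 := real_inner_le_norm (G1 - G0) (x1 - x2)
    have c2 := mul_le_mul_of_nonneg_left c1 (hτm.le.trans hτ)
    have c3 := mul_le_mul_of_nonneg_right hGr (norm_nonneg (x1 - x2))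
    rw [norm_sub_rev x0 x1]
    have c5 := mul_nonneg hμ'.le (sq_nonneg (‖x1 - x0‖ - ‖x1 - x2‖))
    have c4 : τ1 * ⟪G1 - G0, x1 - x2⟫_ℝ ≤ μ' * ‖x1 - x0‖ * ‖x1 - x2‖ := by
      refine c2.trans (le_trans (le_of_eq ?_) c3)
      ring
    clear c1 c2 c3 hb n1 n2 n3 n4 hKr hGr k1
    linarith
  have k3 : ‖xb - z2‖ ^ 2 ≤ 2 * ‖x1 - xb‖ ^ 2 + 2 * ‖x1 - z2‖ ^ 2 := by
    have : ‖xb - z2‖ ≤ ‖x1 - xb‖ + ‖x1 - z2‖ := by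
      rw [norm_sub_rev x1 xb]
      simpa using norm_sub_le_norm_sub_add_norm_sub xb x1 z2
    have p0 := pow_le_pow_left₀ (norm_nonneg (xb - z2)) this 2
    have p1 := sq_nonneg (‖x1 - xb‖ - ‖x1 - z2‖)
    clear hb n1 n2 n3 n4 hKr hGr k1 k2
    linarith
  have k3' := mul_le_mul_of_nonneg_left k3 hε0
  have k4 : 0 ≤ (1 + 1 / ψ - ψ * θ) * ‖x2 - z2‖ ^ 2 := by
    apply mul_nonneg _ (sq_nonneg _)
    have : ψ * θ ≤ ψ := mul_le_of_le_one_right hψ0.le hθ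
    have : ψ ≤ 1 + 1 / ψ := by
      rw [← sub_nonneg]
      have : 1 + 1 / ψ - ψ = (ψ + 1 - ψ ^ 2) / ψ := by field_simp
      rw [this]; exact div_nonneg (by linarith) hψ0.le
    linarith
  have k5 : ψ / (ψ - 1) = 1 + 1 / (ψ - 1) := by
    have : ψ - 1 ≠ 0 := by linarith
    field_simp; ring
  have k6 : (c + μ' + r) * ‖x1 - x2‖ ^ 2 ≤ ψ * θ * ‖x1 - x2‖ ^ 2 :=
    mul_le_mul_of_nonneg_right hc (sq_nonneg _)
  have k7 : 2 * ε * ‖x1 - xb‖ ^ 2 ≤ 2 * (τ1 * γh) * ‖x1 - xb‖ ^ 2 :=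
    mul_le_mul_of_nonneg_right (by have := mul_le_mul_of_nonneg_right hτ hγh.le; linarith) (sq_nonneg _)
  have k8 : 2 * ε * ‖x1 - z2‖ ^ 2 ≤ ψ * θ * ‖x1 - z2‖ ^ 2 :=
    mul_le_mul_of_nonneg_right (by linarith) (sq_nonneg _)
  have k9 : τm * γg * ‖y1 - yb‖ ^ 2 ≤ τ1 * γg * ‖y1 - yb‖ ^ 2 :=
    mul_le_mul_of_nonneg_right (mul_le_mul_of_nonneg_right hτ hγg.le) (sq_nonneg _)
  have n2' : 2 * (ψ * θ * ⟪x1 - z2, x2 - x1⟫_ℝ) =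
      ψ * θ * (‖x2 - z2‖ ^ 2 - ‖x1 - z2‖ ^ 2 - ‖x1 - x2‖ ^ 2) := by rw [← n2]; ring
  have n3' : 2 * (1 / β * ⟪y1 - y0, yb - y1⟫_ℝ) =
      1 / β * (‖yb - y0‖ ^ 2 - ‖y1 - y0‖ ^ 2 - ‖y1 - yb‖ ^ 2) := by rw [← n3]; ring
  rw [norm_sub_rev yb y1]
  have e := congrArg (fun t => t * ‖xb - z2‖ ^ 2) k5
  linarith

lemma pg_geom (E : ℕ → ℝ) (ζ : ℝ) (hζ : 0 < ζ) (N : ℕ) (h : ∀ n, N ≤ n → E (n + 1) ≤ ζ * E n) :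
    ∀ n, N ≤ n → E n ≤ E N / ζ ^ N * ζ ^ n := by
  intro n hn
  induction n, hn using Nat.le_induction with
  | base => field_simp; exact le_rfl
  | succ n hn ih =>
    calc E (n + 1) ≤ ζ * E n := h n hn
      _ ≤ ζ * (E N / ζ ^ N * ζ ^ n) := by gcongr
      _ = _ := by ring

theorem pgrpda_rlinear_rate {X Y : Type*}
    [NormedAddCommGroup X] [InnerProductSpace ℝ X] [FiniteDimensional ℝ X]
    [NormedAddCommGroup Y] [InnerProductSpace ℝ Y] [FiniteDimensional ℝ Y]
    (K : X →L[ℝ] Y) (hK : K ≠ 0)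
    (f : X → ℝ) (gstar : Y → ℝ) (h : X → ℝ) (Gh : X → X)
    (hf : ConvexOn ℝ Set.univ f) (hgstar : ConvexOn ℝ Set.univ gstar)
    (hGh : ∀ a : X, HasGradientAt h (Gh a) a)
    (L : ℝ) (hL : 0 < L) (hLip : ∀ a b : X, ‖Gh a - Gh b‖ ≤ L * ‖a - b‖)
    (γh γg : ℝ) (hγh : 0 < γh) (hγg : 0 < γg)
    (hsch : ∀ a b : X, ⟪Gh b, a - b⟫_ℝ + γh / 2 * ‖a - b‖ ^ 2 ≤ h a - h b)
    (hscg : ∀ (v p u : Y), IsSubgradient gstar u p →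
      ⟪u, v - p⟫_ℝ + γg / 2 * ‖v - p‖ ^ 2 ≤ gstar v - gstar p)
    (ψ β μ μ' : ℝ) (hψ1 : 1 < ψ) (hψφ : ψ ≤ (1 + Real.sqrt 5) / 2)
    (hβ : 0 < β) (hμ'0 : 0 < μ') (hμμ' : 2 * μ' < μ) (hμψ : μ < ψ / 2)
    (x z : ℕ → X) (y : ℕ → Y) (τ : ℕ → ℝ)
    (hτ0 : 0 < τ 0) (hz0 : z 0 = x 0)
    (hz : ∀ n, 1 ≤ n → z n = ((ψ - 1) / ψ) • x (n - 1) + (1 / ψ) • z (n - 1))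
    (hx : ∀ n, 1 ≤ n → ∀ u : X,
      τ (n - 1) * (f (x n) - f u) ≤
        ⟪x n - z n + τ (n - 1) • (ContinuousLinearMap.adjoint K) (y (n - 1))
            + τ (n - 1) • Gh (x (n - 1)), u - x n⟫_ℝ)
    (hτ : ∀ n, 1 ≤ n → τ n = min (τ (n - 1)) (min
        (if ‖K (x n - x (n - 1))‖ = 0 then τ (n - 1)
          else μ * ‖x n - x (n - 1)‖ / (Real.sqrt β * ‖K (x n - x (n - 1))‖))
        (if ‖Gh (x n) - Gh (x (n - 1))‖ = 0 then τ (n - 1)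
          else μ' * ‖x n - x (n - 1)‖ / ‖Gh (x n) - Gh (x (n - 1))‖)))
    (hy : ∀ n, 1 ≤ n → ∀ v : Y,
      β * τ n * (gstar (y n) - gstar v) ≤
        ⟪y n - y (n - 1) - (β * τ n) • K (x n), v - y n⟫_ℝ
          - β * τ n * γg / 2 * ‖v - y n‖ ^ 2)
    (xb : X) (yb : Y)
    (hpd : IsSubgradient f (-(ContinuousLinearMap.adjoint K) yb - Gh xb) xb ∧
      IsSubgradient gstar (K xb) yb)
    (huniq : ∀ (x' : X) (y' : Y),
      IsSubgradient f (-(ContinuousLinearMap.adjoint K) y' - Gh x') x' ∧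
        IsSubgradient gstar (K x') y' → x' = xb ∧ y' = yb)
    (hconv : Filter.Tendsto (fun n => (x n, y n)) Filter.atTop (nhds (xb, yb))) :
    ∃ (Z V₁ V₂ ζ : ℝ) (n₄ : ℕ), 0 < Z ∧ 0 < V₁ ∧ 0 < V₂ ∧ 0 < ζ ∧ ζ < 1 ∧
      ∀ n, n₄ ≤ n →
        ‖xb - z (n + 2)‖ ^ 2 ≤ Z * ζ ^ n ∧
        ‖yb - y n‖ ^ 2 ≤ V₁ * ζ ^ n ∧
        ‖x n - x (n + 1)‖ ^ 2 ≤ V₂ * ζ ^ n ∧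
        ‖x n - xb‖ ≤ Real.sqrt V₂ * Real.sqrt ζ ^ n / (1 - Real.sqrt ζ) := by
  have hs : 0 < Real.sqrt β := Real.sqrt_pos.2 hβ
  have hμ0 : 0 < μ := by linarith
  have hψ2 : ψ ^ 2 ≤ ψ + 1 := by
    have h5 : Real.sqrt 5 ^ 2 = 5 := Real.sq_sqrt (by norm_num)
    nlinarith [Real.sqrt_nonneg 5]
  have hψlt : ψ < 2 := by nlinarith
  have hKn : 0 < ‖K‖ := norm_pos_iff.2 hK
  -- step sizes
  have hτ' : ∀ n, τ (n + 1) = min (τ n) (min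
        (if ‖K (x (n + 1) - x n)‖ = 0 then τ n
          else μ * ‖x (n + 1) - x n‖ / (Real.sqrt β * ‖K (x (n + 1) - x n)‖))
        (if ‖Gh (x (n + 1)) - Gh (x n)‖ = 0 then τ n
          else μ' * ‖x (n + 1) - x n‖ / ‖Gh (x (n + 1)) - Gh (x n)‖)) := by
    intro n; simpa using hτ (n + 1) (by omega)
  have hanti : Antitone τ := antitone_nat_of_succ_le fun n => by
    rw [hτ' n]; exact min_le_left _ _
  obtain ⟨m, hm⟩ : ∃ m, m = min (τ 0) (min (μ / (Real.sqrt β * ‖K‖)) (μ' / L)) := ⟨_, rfl⟩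
  have hm0 : 0 < m := by
    rw [hm]; refine lt_min hτ0 (lt_min ?_ ?_) <;> positivity
  have hm1 : m ≤ μ / (Real.sqrt β * ‖K‖) := by
    rw [hm]; exact (min_le_right _ _).trans (min_le_left _ _)
  have hm2 : m ≤ μ' / L := by
    rw [hm]; exact (min_le_right _ _).trans (min_le_right _ _)
  have hmτ : ∀ n, m ≤ τ n := by
    intro n
    induction n with
    | zero => rw [hm]; exact min_le_left _ _
    | succ n ih =>
      rw [hτ' n]
      refine le_min ih (le_min ?_ ?_)
      · split_ifs with h0
        · exact ih
        · have h1 : 0 < ‖K (x (n + 1) - x n)‖ := lt_of_le_of_ne (norm_nonneg _) (Ne.symm h0)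
          refine hm1.trans ?_
          rw [div_le_div_iff₀ (by positivity) (by positivity)]
          have := K.le_opNorm (x (n + 1) - x n)
          calc μ * (Real.sqrt β * ‖K (x (n + 1) - x n)‖)
              ≤ μ * (Real.sqrt β * (‖K‖ * ‖x (n + 1) - x n‖)) := by gcongr
            _ = _ := by ring
      · split_ifs with h0
        · exact ih
        · have h1 : 0 < ‖Gh (x (n + 1)) - Gh (x n)‖ := lt_of_le_of_ne (norm_nonneg _) (Ne.symm h0)
          refine hm2.trans ?_
          rw [div_le_div_iff₀ (by positivity) (by positivity)]
          have := hLip (x (n + 1)) (x n)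
          calc μ' * ‖Gh (x (n + 1)) - Gh (x n)‖
              ≤ μ' * (L * ‖x (n + 1) - x n‖) := by gcongr
            _ = _ := by ring
  have hτpos : ∀ n, 0 < τ n := fun n => hm0.trans_le (hmτ n)
  have hKb : ∀ n, τ (n + 1) * (Real.sqrt β * ‖K (x (n + 1) - x n)‖) ≤ μ * ‖x (n + 1) - x n‖ := by
    intro n
    by_cases h0 : ‖K (x (n + 1) - x n)‖ = 0
    · rw [h0]; simp; positivity
    · have h1 : 0 < ‖K (x (n + 1) - x n)‖ := lt_of_le_of_ne (norm_nonneg _) (Ne.symm h0)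
      have h2 : τ (n + 1) ≤ μ * ‖x (n + 1) - x n‖ / (Real.sqrt β * ‖K (x (n + 1) - x n)‖) := by
        rw [hτ' n, if_neg h0]; exact (min_le_right _ _).trans (min_le_left _ _)
      rwa [le_div_iff₀ (by positivity)] at h2
  have hGb : ∀ n, τ (n + 1) * ‖Gh (x (n + 1)) - Gh (x n)‖ ≤ μ' * ‖x (n + 1) - x n‖ := by
    intro n
    by_cases h0 : ‖Gh (x (n + 1)) - Gh (x n)‖ = 0
    · rw [h0]; simp; positivity
    · have h1 : 0 < ‖Gh (x (n + 1)) - Gh (x n)‖ := lt_of_le_of_ne (norm_nonneg _) (Ne.symm h0)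
      have h2 : τ (n + 1) ≤ μ' * ‖x (n + 1) - x n‖ / ‖Gh (x (n + 1)) - Gh (x n)‖ := by
        rw [hτ' n, if_neg h0]; exact (min_le_right _ _).trans (min_le_right _ _)
      rwa [le_div_iff₀ h1] at h2
  -- limits
  have hlim := tendsto_atTop_ciInf hanti ⟨m, by rintro _ ⟨n, rfl⟩; exact hmτ n⟩
  have hl0 : (⨅ i, τ i) ≠ 0 := (hm0.trans_le (le_ciInf hmτ)).ne'
  have hlim1 : Tendsto (fun n => τ (n + 1)) atTop (𝓝 (⨅ i, τ i)) :=
    (tendsto_add_atTop_iff_nat 1).2 hlim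
  have hlim2 : Tendsto (fun n => τ (n + 2)) atTop (𝓝 (⨅ i, τ i)) :=
    (tendsto_add_atTop_iff_nat 2).2 hlim
  have hθ : Tendsto (fun n => τ (n + 1) / τ n) atTop (𝓝 1) := by
    have := hlim1.div hlim hl0
    rw [div_self hl0] at this
    exact this
  have hρ : Tendsto (fun n => τ (n + 1) / τ (n + 2)) atTop (𝓝 1) := by
    have := hlim1.div hlim2 hl0
    rw [div_self hl0] at this
    exact this
  obtain ⟨c, hc⟩ : ∃ c, c = μ' + (ψ - μ - 2 * μ') / 2 := ⟨_, rfl⟩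
  have hcμ : μ' < c := by rw [hc]; linarith
  have ev1 : ∀ᶠ n in atTop, μ * (τ (n + 1) / τ (n + 2)) < 1 := by
    have := hρ.const_mul μ
    exact this.eventually_lt_const (by linarith)
  have ev2 : ∀ᶠ n in atTop, 1 < ψ * (τ (n + 1) / τ n) := by
    have := hθ.const_mul ψ
    exact this.eventually_const_lt (by linarith)
  have ev3 : ∀ᶠ n in atTop,
      c + μ' < ψ * (τ (n + 1) / τ n) - μ * (τ (n + 1) / τ (n + 2)) := by
    have := (hθ.const_mul ψ).sub (hρ.const_mul μ)
    exact this.eventually_const_lt (by rw [hc]; linarith)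
  obtain ⟨N, hN⟩ := eventually_atTop.1 (ev1.and (ev2.and ev3))
  obtain ⟨ε, hε⟩ : ∃ ε, ε = min (m * γh) (1 / 2) := ⟨_, rfl⟩
  have hε0 : 0 < ε := by rw [hε]; exact lt_min (by positivity) (by norm_num)
  have hε1 : ε ≤ m * γh := by rw [hε]; exact min_le_left _ _
  have hε2 : ε ≤ 1 / 2 := by rw [hε]; exact min_le_right _ _
  obtain ⟨A, hA⟩ : ∃ A, A = ψ / (ψ - 1) := ⟨_, rfl⟩
  have hA1 : 1 < A := by rw [hA, lt_div_iff₀ (by linarith)]; linarith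
  obtain ⟨B, hB⟩ : ∃ B, B = 1 / β + 2 * m * γg := ⟨_, rfl⟩
  have hβ' : 0 < 1 / β := by positivity
  have hBβ : 1 / β < B := by rw [hB]; have : 0 < 2 * m * γg := by positivity
                             linarith
  have hc0 : 0 < c := by linarith
  have hB0 : 0 < B := by linarith
  have hA0 : 0 < A := by linarith
  have hstep : ∀ n, N ≤ n →
      A * ‖xb - z (n + 1 + 2)‖ ^ 2 + B * ‖yb - y (n + 1)‖ ^ 2 + c * ‖x (n + 1) - x (n + 1 + 1)‖ ^ 2
      ≤ (A - ε) * ‖xb - z (n + 2)‖ ^ 2 + 1 / β * ‖yb - y n‖ ^ 2 + μ' * ‖x n - x (n + 1)‖ ^ 2 := by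
    intro n hn
    obtain ⟨e1, e2, e3⟩ := hN n hn
    have hz2 := hz (n + 2) (by omega)
    have hz3 := hz (n + 3) (by omega)
    have hx1 := hx (n + 1) (by omega) (x (n + 2))
    have hx2 := hx (n + 2) (by omega) xb
    have hy1 := hy (n + 1) (by omega) yb
    simp only [show n + 2 - 1 = n + 1 from rfl, show n + 3 - 1 = n + 2 from rfl,
      show n + 1 - 1 = n from rfl] at hz2 hz3 hx1 hx2 hy1
    have hzz : x (n + 1) - z (n + 1) = ψ • (x (n + 1) - z (n + 2)) := by
      have hp : ψ ≠ 0 := by linarith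
      rw [hz2, smul_sub, smul_add, smul_smul, smul_smul, mul_div_cancel₀ _ hp,
        mul_div_cancel₀ _ hp, sub_smul]
      simp only [one_smul]
      abel
    have hH : γh * ‖x (n + 1) - xb‖ ^ 2 ≤ ⟪Gh (x (n + 1)) - Gh xb, x (n + 1) - xb⟫_ℝ := by
      have a1 := hsch (x (n + 1)) xb
      have a2 := hsch xb (x (n + 1))
      rw [norm_sub_rev xb, ← neg_sub (x (n + 1)) xb, inner_neg_right] at a2
      rw [inner_sub_left]
      linarith
    have hb := pg_basic K f gstar (x n) (x (n + 1)) (x (n + 2)) (z (n + 1)) (z (n + 2)) xb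
      (Gh (x n)) (Gh (x (n + 1))) (Gh xb) (y n) (y (n + 1)) yb (τ n) (τ (n + 1)) β ψ γh γg
      (hτpos _) (hτpos _) hβ hzz hx2 hx1 hy1 (hpd.1 _) (hscg _ _ _ hpd.2) hH
    rw [hA, hB]
    refine pg_step_s10 K (x n) (x (n + 1)) (x (n + 2)) (z (n + 2)) (z (n + 3)) xb
      (Gh (x n)) (Gh (x (n + 1))) (y n) (y (n + 1)) yb (τ (n + 1)) m (τ (n + 1) / τ n)
      (μ * (τ (n + 1) / τ (n + 2))) β ψ μ μ' c ε γh γg hβ hψ1 hψ2 hm0 (hmτ _) hμ'0 ?_ hγh hγg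
      hz3 ?_ (hGb n) ?_ e1.le e2.le (by linarith) (by linarith) (by linarith) hε0.le hb
    · rw [div_le_one (hτpos _)]; exact hanti (Nat.le_succ n)
    · have p := hτpos (n + 2)
      have := mul_le_mul_of_nonneg_left (hKb (n + 1)) (div_pos (hτpos (n + 1)) p).le
      calc _ = τ (n + 1) / τ (n + 2) * (τ (n + 1 + 1) *
            (Real.sqrt β * ‖K (x (n + 1 + 1) - x (n + 1))‖)) := by
              simp only [show n + 1 + 1 = n + 2 from rfl]; field_simp
        _ ≤ _ := this
        _ = _ := by ring
    · have p := hτpos (n + 2)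
      have q := hτpos (n + 1)
      positivity
  obtain ⟨ζ, hζ⟩ : ∃ ζ, ζ = max ((A - ε) / A) (max ((1 / β) / B) (μ' / c)) := ⟨_, rfl⟩
  have z1 : A - ε ≤ ζ * A := by
    rw [← div_le_iff₀ hA0, hζ]; exact le_max_left _ _
  have z2 : 1 / β ≤ ζ * B := by
    rw [← div_le_iff₀ hB0, hζ]; exact (le_max_left _ _).trans (le_max_right _ _)
  have z3 : μ' ≤ ζ * c := by
    rw [← div_le_iff₀ hc0, hζ]; exact (le_max_right _ _).trans (le_max_right _ _)
  have hζ0 : 0 < ζ := by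
    rw [hζ]; exact lt_max_of_lt_right (lt_max_of_lt_right (div_pos hμ'0 hc0))
  have hζ1 : ζ < 1 := by
    rw [hζ]
    refine max_lt ?_ (max_lt ?_ ?_)
    · rw [div_lt_one hA0]; linarith
    · rwa [div_lt_one hB0]
    · rwa [div_lt_one hc0]
  obtain ⟨E, hE⟩ : ∃ E : ℕ → ℝ, E = fun n => A * ‖xb - z (n + 2)‖ ^ 2 + B * ‖yb - y n‖ ^ 2
    + c * ‖x n - x (n + 1)‖ ^ 2 := ⟨_, rfl⟩
  have hEn : ∀ n, E n = A * ‖xb - z (n + 2)‖ ^ 2 + B * ‖yb - y n‖ ^ 2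
    + c * ‖x n - x (n + 1)‖ ^ 2 := fun n => by rw [hE]
  have hEstep : ∀ n, N ≤ n → E (n + 1) ≤ ζ * E n := by
    intro n hn
    rw [hEn, hEn]
    refine (hstep n hn).trans ?_
    have a1 := mul_le_mul_of_nonneg_right z1 (sq_nonneg ‖xb - z (n + 2)‖)
    have a2 := mul_le_mul_of_nonneg_right z2 (sq_nonneg ‖yb - y n‖)
    have a3 := mul_le_mul_of_nonneg_right z3 (sq_nonneg ‖x n - x (n + 1)‖)
    linarith
  have hgeo := pg_geom E ζ hζ0 N hEstep
  obtain ⟨C, hC⟩ : ∃ C, C = E N / ζ ^ N + 1 := ⟨_, rfl⟩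
  have hC0 : 0 < C := by
    rw [hC]
    have : 0 ≤ E N := by rw [hEn]; positivity
    positivity
  have hEC : ∀ n, N ≤ n → E n ≤ C * ζ ^ n := by
    intro n hn
    refine (hgeo n hn).trans ?_
    have : 0 < ζ ^ n := by positivity
    rw [hC]; linarith
  have hV : ∀ n, N ≤ n → ‖x n - x (n + 1)‖ ^ 2 ≤ C / c * ζ ^ n := by
    intro n hn
    have := hEC n hn
    rw [hEn] at this
    rw [div_mul_eq_mul_div, le_div_iff₀ hc0]
    have a1 : 0 ≤ A * ‖xb - z (n + 2)‖ ^ 2 := by positivity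
    have a2 : 0 ≤ B * ‖yb - y n‖ ^ 2 := by positivity
    linarith
  have hsq : Real.sqrt ζ < 1 := by
    rw [Real.sqrt_lt' one_pos]; simpa using hζ1
  refine ⟨C / A, C / B, C / c, ζ, N, by positivity, by positivity, by positivity, hζ0, hζ1, ?_⟩
  intro n hn
  have hEn' := hEC n hn
  rw [hEn] at hEn'
  have a1 : 0 ≤ A * ‖xb - z (n + 2)‖ ^ 2 := by positivity
  have a2 : 0 ≤ B * ‖yb - y n‖ ^ 2 := by positivity
  have a3 : 0 ≤ c * ‖x n - x (n + 1)‖ ^ 2 := by positivity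
  refine ⟨?_, ?_, hV n hn, ?_⟩
  · rw [div_mul_eq_mul_div, le_div_iff₀ hA0]; linarith
  · rw [div_mul_eq_mul_div, le_div_iff₀ hB0]; linarith
  · have hxlim : Tendsto x atTop (𝓝 xb) := (continuous_fst.tendsto _).comp hconv
    have hxlim' : Tendsto (fun k => x (k + n)) atTop (𝓝 xb) :=
      (tendsto_add_atTop_iff_nat n).2 hxlim
    have key := dist_le_of_le_geometric_of_tendsto₀ (Real.sqrt ζ)
      (Real.sqrt (C / c) * Real.sqrt ζ ^ n) hsq (f := fun k => x (k + n)) (a := xb) ?_ hxlim'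
    · simpa [dist_eq_norm] using key
    · intro k
      rw [dist_eq_norm]
      have := hV (k + n) (by omega)
      have e : Real.sqrt (C / c) * Real.sqrt ζ ^ n * Real.sqrt ζ ^ k
          = Real.sqrt (C / c * ζ ^ (k + n)) := by
        have hp : Real.sqrt (ζ ^ (k + n)) = Real.sqrt ζ ^ (k + n) := by
          rw [Real.sqrt_eq_iff_mul_self_eq (by positivity) (by positivity), ← mul_pow,
            Real.mul_self_sqrt hζ0.le]
        rw [Real.sqrt_mul (by positivity), hp, pow_add]; ring
      rw [e]
      apply Real.le_sqrt_of_sq_le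
      rw [show k + 1 + n = k + n + 1 by omega]
      exact this
end
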